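/- arXiv:1708.08260 — 5 statements merged into one kernel-verified Lean document; each statement's English description precedes it below -/
import Mathlib

section
/- Let B be a unital C*-algebra and φ a GNS-essential state on B. Then for every finite subset F of B and every ε > 0 there exists a ∈ B with φ(a) = 0, φ(a*a) = 1, |φ(x a)| < ε for all x ∈ F, and |φ(a* x a) − φ(x)| < ε for all x ∈ F. (Equivalently, there is a net (a_i) in ker φ with φ(a_i* a_i) = 1 for all i, lim_i φ(x a_i) = 0 and lim_i φ(a_i* x a_i) = φ(x) for every x ∈ B.) -/
open scoped InnerProductSpace ComplexOrder

noncomputable section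

/-- A GNS-type representation witnessing that the state `φ` on `B` is GNS-essential:
a Hilbert space `H`, a unital star-algebra homomorphism `π : B → B(H)`, and a cyclic
unit vector `ξ` implementing `φ` as a vector state, such that the only compact operator
in the image of `π` is `0`. -/
structure GNSEssentialWitness (B : Type) [Semiring B] [Algebra ℂ B] [StarRing B]
    (φ : B →ₗ[ℂ] ℂ) where
  H : Type
  [normedH : NormedAddCommGroup H]
  [ipsH : InnerProductSpace ℂ H]
  [completeH : CompleteSpace H]
  π : B →⋆ₐ[ℂ] (H →L[ℂ] H)
  ξ : H
  norm_ξ : ‖ξ‖ = 1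
  cyclic : DenseRange fun b : B => π b ξ
  vector_state : ∀ x : B, φ x = ⟪ξ, π x ξ⟫_ℂ
  essential : ∀ x : B, IsCompactOperator ⇑(π x) → π x = 0

/-- A state `φ` on `B` is GNS-essential if the image of its GNS representation contains
no non-zero compact operator. -/
def IsGNSEssential {B : Type} [Semiring B] [Algebra ℂ B] [StarRing B]
    (φ : B →ₗ[ℂ] ℂ) : Prop :=
  Nonempty (GNSEssentialWitness B φ)

/-- joint essential numerical range -/
def WE {H : Type*} [NormedAddCommGroup H] [InnerProductSpace ℂ H] {ι : Type*}
    (T : ι → H →L[ℂ] H) : Set (ι → ℂ) :=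
  {z | ∀ s : Finset H, ∀ δ : ℝ, 0 < δ → ∃ v : H, ‖v‖ = 1 ∧ (∀ w ∈ s, ⟪w, v⟫_ℂ = 0) ∧
    ∀ i, ‖⟪v, T i v⟫_ℂ - z i‖ < δ}

theorem WE_closed {H : Type*} [NormedAddCommGroup H] [InnerProductSpace ℂ H] {ι : Type*}
    [Fintype ι] (T : ι → H →L[ℂ] H) : IsClosed (WE T) := by
  refine isClosed_of_closure_subset fun z hz s δ hδ => ?_
  obtain ⟨y, hy, hyz⟩ := Metric.mem_closure_iff.1 hz (δ / 2) (by positivity)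
  obtain ⟨v, hv, hs, hT⟩ := hy s (δ / 2) (by positivity)
  refine ⟨v, hv, hs, fun i => ?_⟩
  have h1 := hT i
  have h2 : ‖y i - z i‖ < δ / 2 := by
    rw [← dist_eq_norm, dist_comm]
    exact (dist_le_pi_dist z y i).trans_lt hyz
  calc ‖⟪v, T i v⟫_ℂ - z i‖ = ‖(⟪v, T i v⟫_ℂ - y i) + (y i - z i)‖ := by congr 1; ring
    _ ≤ _ := norm_add_le _ _
    _ < δ := by linarith

theorem WE_convex {H : Type*} [NormedAddCommGroup H] [InnerProductSpace ℂ H] [CompleteSpace H]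
    {ι : Type*} [Fintype ι] (T : ι → H →L[ℂ] H) : Convex ℝ (WE T) := by
  classical
  intro x hx y hy a b ha hb hab s δ hδ
  obtain ⟨e, he, hes, heT⟩ := hx s δ hδ
  obtain ⟨f, hf, hfs, hfT⟩ := hy (s ∪ ({e} ∪ (Finset.univ.image (fun i => T i e) ∪
    Finset.univ.image (fun i => (T i).adjoint e)))) δ hδ
  have hef : ⟪e, f⟫_ℂ = 0 := hfs e (by simp)
  have hfe : ⟪f, e⟫_ℂ = 0 := inner_eq_zero_symm.1 hef
  have h1 : ∀ i, ⟪f, T i e⟫_ℂ = 0 := fun i => inner_eq_zero_symm.1 (hfs _ (by simp))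
  have h2 : ∀ i, ⟪e, T i f⟫_ℂ = 0 := fun i => by
    rw [← ContinuousLinearMap.adjoint_inner_left]; exact hfs _ (by simp)
  have sa : ((√a : ℝ) : ℂ) * ((√a : ℝ) : ℂ) = a := by
    rw [← Complex.ofReal_mul, Real.mul_self_sqrt ha]
  have sb : ((√b : ℝ) : ℂ) * ((√b : ℝ) : ℂ) = b := by
    rw [← Complex.ofReal_mul, Real.mul_self_sqrt hb]
  refine ⟨((√a : ℝ) : ℂ) • e + ((√b : ℝ) : ℂ) • f, ?_, ?_, ?_⟩
  · have h : (‖((√a : ℝ) : ℂ) • e + ((√b : ℝ) : ℂ) • f‖ : ℂ) ^ 2 = 1 := by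
      have := inner_self_eq_norm_sq_to_K (𝕜 := ℂ) (((√a : ℝ) : ℂ) • e + ((√b : ℝ) : ℂ) • f)
      rw [show (‖((√a : ℝ) : ℂ) • e + ((√b : ℝ) : ℂ) • f‖ : ℂ) ^ 2 = _ from this.symm]
      simp only [inner_add_left, inner_add_right, inner_smul_left, inner_smul_right, hef, hfe,
        Complex.conj_ofReal]
      have i1 : ⟪e, e⟫_ℂ = 1 := by rw [inner_self_eq_norm_sq_to_K, he]; simp
      have i2 : ⟪f, f⟫_ℂ = 1 := by rw [inner_self_eq_norm_sq_to_K, hf]; simp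
      have hab' : (a : ℂ) + b = 1 := by exact_mod_cast hab
      rw [i1, i2]
      linear_combination sa + sb + hab'
    have h' : ‖((√a : ℝ) : ℂ) • e + ((√b : ℝ) : ℂ) • f‖ ^ 2 = 1 := by exact_mod_cast h
    exact (pow_eq_one_iff_of_nonneg (norm_nonneg _) two_ne_zero).1 h'
  · intro w hw
    rw [inner_add_right, inner_smul_right, inner_smul_right, hes w hw, hfs w (by simp [hw])]
    simp
  · intro i
    have : ⟪((√a : ℝ) : ℂ) • e + ((√b : ℝ) : ℂ) • f, T i (((√a : ℝ) : ℂ) • e + ((√b : ℝ) : ℂ) • f)⟫_ℂ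
        - (a • x + b • y) i = a * (⟪e, T i e⟫_ℂ - x i) + b * (⟪f, T i f⟫_ℂ - y i) := by
      simp only [map_add, map_smul, inner_add_left, inner_add_right, inner_smul_left,
        inner_smul_right, h1, h2, Complex.conj_ofReal, Pi.add_apply, Pi.smul_apply,
        Complex.real_smul]
      linear_combination ⟪e, T i e⟫_ℂ * sa + ⟪f, T i f⟫_ℂ * sb
    rw [this]
    have hb' : b = 1 - a := by linarith
    have n1 : ‖(a:ℂ) * (⟪e, T i e⟫_ℂ - x i)‖ = a * ‖⟪e, T i e⟫_ℂ - x i‖ := by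
      rw [norm_mul, Complex.norm_real, Real.norm_of_nonneg ha]
    have n2 : ‖(b:ℂ) * (⟪f, T i f⟫_ℂ - y i)‖ = b * ‖⟪f, T i f⟫_ℂ - y i‖ := by
      rw [norm_mul, Complex.norm_real, Real.norm_of_nonneg hb]
    refine (norm_add_le _ _).trans_lt ?_
    rw [n1, n2]
    have e1 := heT i
    have e2 := hfT i
    rcases ha.eq_or_lt with h0 | h0
    · have : b = 1 := by linarith
      rw [← h0, this]; linarith
    · nlinarith [mul_lt_mul_of_pos_left e1 h0, mul_le_mul_of_nonneg_left e2.le hb]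

/-- compactness: a functional value reachable orthogonally to every finite set
is reached in WE. -/
theorem WE_point {H : Type*} [NormedAddCommGroup H] [InnerProductSpace ℂ H]
    {ι : Type*} [Fintype ι] (T : ι → H →L[ℂ] H) (f : (ι → ℂ) →L[ℂ] ℂ) (r : ℝ)
    (h : ∀ s : Finset H, ∀ δ : ℝ, 0 < δ → ∃ v : H, ‖v‖ = 1 ∧ (∀ w ∈ s, ⟪w, v⟫_ℂ = 0) ∧
      r - δ < (f (fun i => ⟪v, T i v⟫_ℂ)).re) :
    ∃ z ∈ WE T, r ≤ (f z).re := by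
  classical
  choose! v hv hs hr using h
  let u : Finset H × ℕ → (ι → ℂ) := fun p i =>
    ⟪v p.1 (1 / ((p.2 : ℝ) + 1)), T i (v p.1 (1 / ((p.2 : ℝ) + 1)))⟫_ℂ
  have hpos : ∀ n : ℕ, (0:ℝ) < 1 / ((n : ℝ) + 1) := fun n => by positivity
  have hK : IsCompact (Set.pi Set.univ fun i => Metric.closedBall (0:ℂ) ‖T i‖) :=
    isCompact_univ_pi fun i => isCompact_closedBall _ _
  have hu : ∀ p, u p ∈ (Set.pi Set.univ fun i => Metric.closedBall (0:ℂ) ‖T i‖) := by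
    intro p i _
    rw [mem_closedBall_zero_iff]
    have h1 := hv p.1 _ (hpos p.2)
    calc ‖u p i‖ ≤ ‖v p.1 (1 / ((p.2 : ℝ) + 1))‖ * ‖T i (v p.1 (1 / ((p.2 : ℝ) + 1)))‖ :=
          norm_inner_le_norm _ _
      _ ≤ ‖T i‖ := by
          rw [h1, one_mul]
          have h2 := (T i).le_opNorm (v p.1 (1 / ((p.2 : ℝ) + 1)))
          rwa [h1, mul_one] at h2
  obtain ⟨z, -, hz⟩ := hK.exists_mapClusterPt (u := u)
    (f := Filter.atTop) (Filter.tendsto_principal.2 (Filter.Eventually.of_forall hu))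
  have key : ∀ U ∈ nhds z, ∀ p0 : Finset H × ℕ, ∃ p ≥ p0, u p ∈ U := by
    intro U hU p0
    have := (mapClusterPt_iff_frequently.1 hz U hU)
    exact Filter.frequently_atTop.1 this p0
  refine ⟨z, ?_, ?_⟩
  · intro s δ hδ
    obtain ⟨p, hp, hpU⟩ := key _ (Metric.ball_mem_nhds z hδ) (s, 0)
    refine ⟨v p.1 (1 / ((p.2 : ℝ) + 1)), hv _ _ (hpos _), fun w hw => hs _ _ (hpos _) w (hp.1 hw), fun i => ?_⟩
    have := (dist_le_pi_dist (u p) z i).trans_lt hpU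
    rwa [dist_eq_norm] at this
  · refine le_of_forall_pos_lt_add fun δ hδ => ?_
    obtain ⟨n, hn⟩ := exists_nat_one_div_lt (half_pos hδ)
    have hc : Continuous fun y : ι → ℂ => (f y).re := Complex.continuous_re.comp f.continuous
    have hU : {y : ι → ℂ | (f y).re < (f z).re + δ / 2} ∈ nhds z :=
      (isOpen_lt hc continuous_const).mem_nhds (by simp [hδ])
    obtain ⟨p, hp, hpU⟩ := key _ hU (∅, n)
    have h1 := hr p.1 _ (hpos p.2)
    have h2 : 1 / ((p.2 : ℝ) + 1) ≤ 1 / ((n : ℝ) + 1) := by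
      apply one_div_le_one_div_of_le (by positivity)
      have : n ≤ p.2 := hp.2
      have : (n : ℝ) ≤ p.2 := by exact_mod_cast this
      linarith
    have h3 : (f (u p)).re < (f z).re + δ / 2 := hpU
    have h4 : r - 1 / ((p.2 : ℝ) + 1) < (f (u p)).re := h1
    linarith

/-- An operator whose range meets the orthogonal complement of a finite set trivially is compact. -/
theorem compact_of_range {H : Type*} [NormedAddCommGroup H] [InnerProductSpace ℂ H]
    [CompleteSpace H] (D : H →L[ℂ] H) (s : Finset H)
    (h : ∀ w, (∀ y ∈ s, ⟪y, D w⟫_ℂ = 0) → D w = 0) : IsCompactOperator D := by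
  let L : H →ₗ[ℂ] (s → ℂ) := LinearMap.pi fun y => (innerSL ℂ (y : H)).toLinearMap
  have hfd : FiniteDimensional ℂ (LinearMap.range D.toLinearMap) := by
    let M : LinearMap.range D.toLinearMap →ₗ[ℂ] (s → ℂ) := L.comp (Submodule.subtype _)
    apply FiniteDimensional.of_injective M
    rw [← LinearMap.ker_eq_bot, LinearMap.ker_eq_bot']
    rintro ⟨_, w, rfl⟩ hw
    ext
    refine h w fun y hy => ?_
    exact congrFun hw ⟨y, hy⟩
  let D' : H →L[ℂ] LinearMap.range D.toLinearMap :=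
    D.codRestrict _ (fun w => ⟨w, rfl⟩)
  have : IsCompactOperator D' := by
    have := FiniteDimensional.proper ℂ (LinearMap.range D.toLinearMap)
    refine ⟨Metric.closedBall 0 ‖D'‖, isCompact_closedBall _ _, ?_⟩
    filter_upwards [Metric.closedBall_mem_nhds (0:H) one_pos] with w hw
    rw [mem_closedBall_zero_iff] at hw
    simp only [Set.mem_preimage, mem_closedBall_zero_iff]
    exact (D'.le_opNorm w).trans (by nlinarith [norm_nonneg D'])
  exact this.clm_comp (LinearMap.range D.toLinearMap).subtypeL

theorem exists_parts {B : Type} [NormedRing B] [StarRing B] [CStarRing B]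
    [NormedAlgebra ℂ B] [CompleteSpace B] [StarModule ℂ B] (c : B) (hc : IsSelfAdjoint c) :
    ∃ d e : B, star d = d ∧ star e = e ∧ c = d * d - e * e ∧ e * d = 0 := by
  letI : CStarAlgebra B := {}
  refine ⟨cfc (fun t : ℝ => √(max t 0)) c, cfc (fun t : ℝ => √(max (-t) 0)) c,
    IsSelfAdjoint.cfc, IsSelfAdjoint.cfc, ?_, ?_⟩
  · rw [← cfc_mul .., ← cfc_mul .., ← cfc_sub ..]
    conv_lhs => rw [← cfc_id ℝ c]
    refine cfc_congr fun t _ => ?_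
    simp only [id]
    rw [Real.mul_self_sqrt (le_max_right _ _), Real.mul_self_sqrt (le_max_right _ _)]
    rcases le_total t 0 with h | h
    · rw [max_eq_right h, max_eq_left (by linarith)]; ring
    · rw [max_eq_left h, max_eq_right (by linarith)]; ring
  · rw [← cfc_mul ..]
    conv_rhs => rw [← cfc_zero ℝ c]
    refine cfc_congr fun t _ => ?_
    simp only [Pi.zero_apply]
    rcases le_total t 0 with h | h
    · rw [max_eq_right h]; simp
    · rw [max_eq_right (a := -t) (by linarith)]; simp

theorem essential_large {B : Type} [NormedRing B] [StarRing B] [CStarRing B]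
    [NormedAlgebra ℂ B] [CompleteSpace B] [StarModule ℂ B]
    {H : Type*} [NormedAddCommGroup H] [InnerProductSpace ℂ H] [CompleteSpace H]
    (π : B →⋆ₐ[ℂ] (H →L[ℂ] H)) (ξ : H) (hξ : ‖ξ‖ = 1)
    (ess : ∀ x : B, IsCompactOperator ⇑(π x) → π x = 0) (b : B)
    (s : Finset H) (δ : ℝ) (hδ : 0 < δ) :
    ∃ v : H, ‖v‖ = 1 ∧ (∀ w ∈ s, ⟪w, v⟫_ℂ = 0) ∧
      (⟪ξ, π b ξ⟫_ℂ).re - δ < (⟪v, π b v⟫_ℂ).re := by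
  by_contra! hcon
  set r := (⟪ξ, π b ξ⟫_ℂ).re with hr
  have hstar : ∀ (x : B) (v w : H), ⟪v, π (star x) w⟫_ℂ = ⟪π x v, w⟫_ℂ := by
    intro x v w
    rw [map_star, ContinuousLinearMap.star_eq_adjoint, ContinuousLinearMap.adjoint_inner_right]
  set c : B := b + star b - ((2 * (r - δ / 2) : ℝ) : ℂ) • 1 with hcdef
  have hc : IsSelfAdjoint c := by
    simp only [IsSelfAdjoint, hcdef, star_sub, star_add, star_star, star_smul, star_one,
      RCLike.star_def, Complex.conj_ofReal]
    rw [add_comm]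
  have hcv : ∀ v : H, (⟪v, π c v⟫_ℂ).re = 2 * ((⟪v, π b v⟫_ℂ).re - (r - δ / 2) * ‖v‖ ^ 2) := by
    intro v
    have h1 : (⟪v, π (star b) v⟫_ℂ).re = (⟪v, π b v⟫_ℂ).re := by
      rw [hstar, ← inner_conj_symm, Complex.conj_re]
    have h2 : (⟪v, v⟫_ℂ).re = ‖v‖ ^ 2 := inner_self_eq_norm_sq (𝕜 := ℂ) v
    simp only [hcdef, map_sub, map_add, map_smul, map_one, ContinuousLinearMap.sub_apply,
      ContinuousLinearMap.add_apply, ContinuousLinearMap.smul_apply, inner_sub_right,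
      inner_add_right, inner_smul_right, Complex.sub_re, Complex.add_re, Complex.re_ofReal_mul,
      ContinuousLinearMap.one_apply, h1, h2]
    ring
  obtain ⟨d, e, hd, he, hce, hed⟩ := exists_parts c hc
  have hsq : ∀ x : B, star x = x → ∀ v : H, (⟪v, π (x * x) v⟫_ℂ).re = ‖π x v‖ ^ 2 := by
    intro x hx v
    have h2 : (⟪π x v, π x v⟫_ℂ).re = ‖π x v‖ ^ 2 := inner_self_eq_norm_sq (𝕜 := ℂ) (π x v)
    rw [← h2, ← hstar, hx, map_mul]; rfl
  have hcv2 : ∀ v : H, (⟪v, π c v⟫_ℂ).re = ‖π d v‖ ^ 2 - ‖π e v‖ ^ 2 := by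
    intro v
    rw [hce, map_sub, ContinuousLinearMap.sub_apply, inner_sub_right, Complex.sub_re, hsq d hd,
      hsq e he]
  have hcomp : IsCompactOperator (π d) := by
    refine compact_of_range _ s fun w hw => ?_
    by_contra hne
    set v := π d w with hv
    have hn : 0 < ‖v‖ := norm_pos_iff.2 hne
    have h0 : π e v = 0 := by
      have : π (e * d) w = 0 := by rw [hed]; simp
      rwa [map_mul] at this
    have h1 := hcon (((‖v‖⁻¹ : ℝ) : ℂ) • v) (by
      rw [norm_smul, Complex.norm_real, norm_inv, norm_norm, inv_mul_cancel₀ hn.ne'])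
      (fun y hy => by rw [inner_smul_right, hw y hy, mul_zero])
    rw [map_smul, inner_smul_left, inner_smul_right, Complex.conj_ofReal, Complex.re_ofReal_mul,
      Complex.re_ofReal_mul] at h1
    have h2 := hcv v
    rw [hcv2, h0, norm_zero] at h2
    have h3 : (⟪v, π b v⟫_ℂ).re ≥ (r - δ / 2) * ‖v‖ ^ 2 := by nlinarith [sq_nonneg ‖π d v‖]
    have h4 : ‖v‖⁻¹ * (‖v‖⁻¹ * (⟪v, π b v⟫_ℂ).re) ≥ r - δ / 2 := by
      have : ‖v‖⁻¹ * (‖v‖⁻¹ * ((r - δ / 2) * ‖v‖ ^ 2)) = r - δ / 2 := by field_simp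
      rw [← this]
      gcongr
    linarith
  have hd0 := ess d hcomp
  have h1 := hcv ξ
  rw [hcv2, hd0, hξ, ← hr] at h1
  simp at h1
  nlinarith [sq_nonneg ‖π e ξ‖]

theorem state_mem_WE {B : Type} [NormedRing B] [StarRing B] [CStarRing B]
    [NormedAlgebra ℂ B] [CompleteSpace B] [StarModule ℂ B]
    {H : Type*} [NormedAddCommGroup H] [InnerProductSpace ℂ H] [CompleteSpace H]
    (π : B →⋆ₐ[ℂ] (H →L[ℂ] H)) (ξ : H) (hξ : ‖ξ‖ = 1)
    (ess : ∀ x : B, IsCompactOperator ⇑(π x) → π x = 0) {ι : Type*} [Fintype ι] (x : ι → B) :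
    (fun i => ⟪ξ, π (x i) ξ⟫_ℂ) ∈ WE (fun i => π (x i)) := by
  classical
  by_contra hn
  obtain ⟨f, u, hu, hu2⟩ := RCLike.geometric_hahn_banach_closed_point (𝕜 := ℂ)
    (WE_convex (fun i => π (x i))) (WE_closed _) hn
  have hf : ∀ v : H, f (fun i => ⟪v, π (x i) v⟫_ℂ) =
      ⟪v, π (∑ i, f (Pi.single i 1) • x i) v⟫_ℂ := by
    intro v
    have h1 : (fun i => ⟪v, π (x i) v⟫_ℂ) =
        ∑ i, ⟪v, π (x i) v⟫_ℂ • (Pi.single i 1 : ι → ℂ) := by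
      ext j; simp [Finset.sum_apply, Pi.single_apply]
    rw [h1, map_sum, map_sum, ContinuousLinearMap.sum_apply, inner_sum]
    refine Finset.sum_congr rfl fun i _ => ?_
    rw [map_smul, map_smul, ContinuousLinearMap.smul_apply, inner_smul_right, smul_eq_mul, mul_comm]
  obtain ⟨z, hz, hzr⟩ := WE_point (fun i => π (x i)) f (f fun i => ⟪ξ, π (x i) ξ⟫_ℂ).re (by
    intro s δ hδ
    simp only [hf]
    exact essential_large π ξ hξ ess _ s δ hδ)
  have := hu z hz
  simp only [RCLike.re_eq_complex_re] at this hu2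
  linarith

/-- Glimm's lemma: for a GNS-essential state `φ` on a unital C*-algebra `B`, every finite
subset `F` and `ε > 0` admit `a ∈ ker φ` with `φ(a*a) = 1`, `|φ(x a)| < ε` and
`|φ(a* x a) - φ(x)| < ε` for all `x ∈ F`. -/
theorem glimm_lemma {B : Type} [NormedRing B] [StarRing B] [CStarRing B]
    [NormedAlgebra ℂ B] [CompleteSpace B] [StarModule ℂ B]
    (φ : B →ₗ[ℂ] ℂ) (hφ_unital : φ 1 = 1) (hφ_pos : ∀ a : B, 0 ≤ φ (star a * a))
    (hφ_ess : IsGNSEssential φ)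
    (F : Finset B) (ε : ℝ) (hε : 0 < ε) :
    ∃ a : B, φ a = 0 ∧ φ (star a * a) = 1 ∧
      ∀ x ∈ F, ‖φ (x * a)‖ < ε ∧ ‖φ (star a * x * a) - φ x‖ < ε := by
  classical
  obtain ⟨W⟩ := hφ_ess
  obtain ⟨H, π, ξ, hξ, cyc, hvs, ess⟩ := W
  have hstar : ∀ (x : B) (v w : H), ⟪v, π (star x) w⟫_ℂ = ⟪π x v, w⟫_ℂ := by
    intro x v w
    rw [map_star, ContinuousLinearMap.star_eq_adjoint, ContinuousLinearMap.adjoint_inner_right]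
  obtain ⟨η, hη, hs, hT⟩ := state_mem_WE π ξ hξ ess (fun i : F => (i : B))
    ({ξ} ∪ F.image (fun x => π (star x) ξ)) ε hε
  have hξη : ⟪ξ, η⟫_ℂ = 0 := hs ξ (by simp)
  let p : H → H := fun ζ => ζ - ⟪ξ, ζ⟫_ℂ • ξ
  let g : H → H := fun ζ => ((‖p ζ‖⁻¹ : ℝ) : ℂ) • p ζ
  have hp : Continuous p := by fun_prop
  have hpη : p η = η := by simp [p, hξη]
  have hgη : g η = η := by simp [g, hpη, hη]
  have hg : ContinuousAt g η := by
    have : ContinuousAt (fun ζ => ‖p ζ‖⁻¹) η :=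
      (hp.norm.continuousAt).inv₀ (by rw [hpη, hη]; exact one_ne_zero)
    exact (Complex.continuous_ofReal.continuousAt.comp this).smul hp.continuousAt
  have ev1 : ∀ᶠ ζ in nhds η, ‖p ζ‖ ≠ 0 :=
    hp.norm.continuousAt.eventually_ne (by rw [hpη, hη]; exact one_ne_zero)
  have ev2 : ∀ x ∈ F, ∀ᶠ ζ in nhds η,
      ‖⟪ξ, π x (g ζ)⟫_ℂ‖ < ε ∧ ‖⟪g ζ, π x (g ζ)⟫_ℂ - φ x‖ < ε := by
    intro x hx
    have c1 : Continuous fun w : H => ‖⟪ξ, π x w⟫_ℂ‖ := by fun_prop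
    have c2 : Continuous fun w : H => ‖⟪w, π x w⟫_ℂ - φ x‖ := by fun_prop
    have d1 := (c1.continuousAt (x := g η)).comp hg
    have d2 := (c2.continuousAt (x := g η)).comp hg
    refine (d1.eventually_lt continuousAt_const ?_).and (d2.eventually_lt continuousAt_const ?_)
    · have h0 : ⟪π (star x) ξ, η⟫_ℂ = 0 :=
        hs _ (Finset.mem_union_right _ (Finset.mem_image_of_mem _ hx))
      rw [← hstar, star_star] at h0
      simp only [Function.comp, hgη, h0, norm_zero]; exact hε
    · have := hT ⟨x, hx⟩
      simp only [Function.comp, hgη]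
      rw [hvs x]; exact this
  have ev := ev1.and ((Filter.eventually_all_finset F).2 ev2)
  obtain ⟨ζ, ⟨hζ1, hζ2⟩, a0, ha0⟩ := (mem_closure_iff_nhds.1 (cyc η)) _ ev
  set k : ℂ := ((‖p ζ‖⁻¹ : ℝ) : ℂ) with hk
  set a : B := k • (a0 - ⟪ξ, ζ⟫_ℂ • (1 : B)) with ha
  have ha0' : π a0 ξ = ζ := ha0
  have hag : π a ξ = g ζ := by
    simp [ha, g, p, hk, ha0']
  have hng : ‖g ζ‖ = 1 := by
    simp only [g]
    rw [norm_smul, Complex.norm_real, norm_inv, norm_norm, inv_mul_cancel₀ hζ1]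
  have hin : ∀ v : H, ‖v‖ = 1 → ⟪v, v⟫_ℂ = 1 := by
    intro v hv
    rw [inner_self_eq_norm_sq_to_K, hv]; simp
  refine ⟨a, ?_, ?_, fun x hx => ⟨?_, ?_⟩⟩
  · rw [hvs, hag]
    simp only [g, p]
    rw [inner_smul_right, inner_sub_right, inner_smul_right, hin ξ hξ]; simp
  · rw [hvs, map_mul, ContinuousLinearMap.mul_apply, hstar, hag, hin _ hng]
  · rw [hvs, map_mul, ContinuousLinearMap.mul_apply, hag]
    exact (hζ2 x hx).1
  · rw [hvs (star a * x * a), mul_assoc, map_mul, ContinuousLinearMap.mul_apply, hstar, map_mul,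
      ContinuousLinearMap.mul_apply, hag]
    exact (hζ2 x hx).2
end
end

section
/- Let B be a unital C*-algebra and φ a GNS-essential tracial state on B (tracial means φ(x y) = φ(y x) for all x, y ∈ B). Then for every finite subset F of B and every ε > 0 there exists b ∈ B with φ(b) = 0, φ(b b*) = 1, |φ(x b)| < ε for all x ∈ F, and |φ(b* x b) − φ(x)| < ε for all x ∈ F. -/
open scoped InnerProductSpace ComplexOrder

noncomputable section

theorem decomp {B : Type} [CStarAlgebra B] (a : B) (ha : IsSelfAdjoint a) :
    ∃ r s : B, IsSelfAdjoint r ∧ IsSelfAdjoint s ∧ a = r * r - s * s ∧ r * s = 0 := by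
  have c1 : Continuous fun t : ℝ => Real.sqrt (max t 0) := by fun_prop
  have c2 : Continuous fun t : ℝ => Real.sqrt (max (-t) 0) := by fun_prop
  refine ⟨cfc (fun t : ℝ => Real.sqrt (max t 0)) a, cfc (fun t : ℝ => Real.sqrt (max (-t) 0)) a,
    cfc_predicate _ a, cfc_predicate _ a, ?_, ?_⟩
  · rw [← cfc_mul _ _ a c1.continuousOn c1.continuousOn,
      ← cfc_mul _ _ a c2.continuousOn c2.continuousOn,
      ← cfc_sub _ _ a (by fun_prop) (by fun_prop)]
    conv_lhs => rw [← cfc_id ℝ a]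
    congr 1
    funext t
    simp only [id]
    rw [Real.mul_self_sqrt (le_max_right _ _), Real.mul_self_sqrt (le_max_right _ _)]
    rcases le_total t 0 with h | h
    · rw [max_eq_right h, max_eq_left (by linarith)]; ring
    · rw [max_eq_left h, max_eq_right (by linarith)]; ring
  · rw [← cfc_mul _ _ a c1.continuousOn c2.continuousOn]
    rw [← cfc_zero ℝ a]
    congr 1
    funext t
    rcases le_total t 0 with h | h
    · simp [max_eq_right h]
    · simp [max_eq_right (show -t ≤ 0 by linarith)]

theorem finrank_compact {H : Type} [NormedAddCommGroup H] [InnerProductSpace ℂ H] [CompleteSpace H]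
    (T : H →L[ℂ] H) (V : Submodule ℂ H) [FiniteDimensional ℂ V]
    (h : ∀ η, T η ∈ Vᗮ → T η = 0) : IsCompactOperator T := by
  have hf : FiniteDimensional ℂ (LinearMap.range T.toLinearMap) := by
    let f : LinearMap.range T.toLinearMap →ₗ[ℂ] V :=
      V.orthogonalProjectionOnto.toLinearMap ∘ₗ (LinearMap.range T.toLinearMap).subtype
    apply FiniteDimensional.of_injective f
    rw [injective_iff_map_eq_zero]
    rintro ⟨_, η, rfl⟩ h0
    have : T η ∈ Vᗮ := by
      have h1 : V.orthogonalProjectionOnto (T η) = 0 := h0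
      simpa using h1
    exact Subtype.ext (h η this)
  let T' : H →L[ℂ] LinearMap.range T.toLinearMap :=
    T.codRestrict _ (fun x => LinearMap.mem_range_self T.toLinearMap x)
  have : FiniteDimensional ℂ (LinearMap.range T.toLinearMap) := hf
  have : ProperSpace (LinearMap.range T.toLinearMap) := FiniteDimensional.proper ℂ _
  have h1 : IsCompactOperator (id : LinearMap.range T.toLinearMap → LinearMap.range T.toLinearMap) :=
    ⟨Metric.closedBall 0 1, isCompact_closedBall 0 1, by
      simpa using Metric.closedBall_mem_nhds 0 one_pos⟩
  have h2 := (h1.comp_clm T').clm_comp (LinearMap.range T.toLinearMap).subtypeL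
  exact h2

theorem re_inner_self {H : Type} [NormedAddCommGroup H] [InnerProductSpace ℂ H] (u : H) :
    (⟪u, u⟫_ℂ).re = ‖u‖ ^ 2 := inner_self_eq_norm_sq (𝕜 := ℂ) u

theorem key {B : Type} [CStarAlgebra B] (φ : B →ₗ[ℂ] ℂ)
    {H : Type} [NormedAddCommGroup H] [InnerProductSpace ℂ H] [CompleteSpace H]
    (π : B →⋆ₐ[ℂ] (H →L[ℂ] H)) (ξ : H) (hξ : ‖ξ‖ = 1) (hv : ∀ x : B, φ x = ⟪ξ, π x ξ⟫_ℂ)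
    (he : ∀ x : B, IsCompactOperator ⇑(π x) → π x = 0)
    (z : B) (V : Submodule ℂ H) [FiniteDimensional ℂ V] (δ : ℝ) (hδ : 0 < δ) :
      ∃ η ∈ Vᗮ, ‖η‖ = 1 ∧ (⟪η, π z η⟫_ℂ).re ≤ (φ z).re + δ := by
  by_contra! hcon
  have hadj : ∀ (x : B) (u v : H), ⟪u, π x v⟫_ℂ = ⟪π (star x) u, v⟫_ℂ := by
    intro x u v
    rw [map_star, ContinuousLinearMap.star_eq_adjoint, ContinuousLinearMap.adjoint_inner_left]
  have hre : ∀ u : H, (⟪u, π (star z) u⟫_ℂ).re = (⟪u, π z u⟫_ℂ).re := by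
    intro u
    rw [hadj, star_star, ← inner_conj_symm, Complex.conj_re]
  set c : ℝ := (φ z).re + δ with hcdef
  let a : B := z + star z - ((2 * c : ℝ) : ℂ) • (1 : B)
  have ha : IsSelfAdjoint a := by
    refine ((IsSelfAdjoint.add_star_self z)).sub ?_
    rw [isSelfAdjoint_iff, star_smul, star_one]
    simp
  have hinner : ∀ u : H, (⟪u, π a u⟫_ℂ).re = 2 * (⟪u, π z u⟫_ℂ).re - 2 * c * ‖u‖ ^ 2 := by
    intro u
    simp only [a, map_sub, map_add, map_smul, map_one, ContinuousLinearMap.sub_apply,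
      ContinuousLinearMap.add_apply, ContinuousLinearMap.smul_apply, ContinuousLinearMap.one_apply,
      inner_sub_right, inner_add_right, inner_smul_right, Complex.sub_re,
      Complex.add_re, Complex.re_ofReal_mul]
    rw [hre, re_inner_self]
    ring
  have hpos : ∀ u ∈ Vᗮ, 0 ≤ (⟪u, π a u⟫_ℂ).re := by
    intro u hu
    by_cases h0 : u = 0
    · simp [h0]
    have hn : 0 < ‖u‖ := norm_pos_iff.2 h0
    have := hcon (((‖u‖⁻¹ : ℝ) : ℂ) • u) (Submodule.smul_mem _ _ hu) (by
      rw [norm_smul]; simp [hn.ne'])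
    rw [map_smul, inner_smul_left, inner_smul_right, Complex.conj_ofReal, Complex.re_ofReal_mul,
      Complex.re_ofReal_mul] at this
    rw [hinner]
    have h3 : c * ‖u‖^2 < (⟪u, π z u⟫_ℂ).re := by
      have := mul_lt_mul_of_pos_right this (pow_pos hn 2)
      refine this.trans_eq ?_
      field_simp
    linarith
  obtain ⟨r, s, hr, hs, hars, hrs⟩ := decomp a ha
  have hz : π (s * s) = 0 := by
    apply he
    apply finrank_compact (π (s * s)) V
    intro η hη
    have h5 := hpos _ hη
    have h6 : ⟪π (s * s) η, π a (π (s * s) η)⟫_ℂ = - ⟪π (s*s*s) η, π (s * s * s) η⟫_ℂ := by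
      have e1 : star (s * s) = s * s := by rw [star_mul, hs.star_eq]
      have e2 : star (s * s * s) = s * s * s := by rw [star_mul, e1, hs.star_eq, mul_assoc]
      rw [hadj a, ← ContinuousLinearMap.mul_apply, ← map_mul, ha.star_eq]
      rw [hadj (s*s*s), ← ContinuousLinearMap.mul_apply, ← map_mul, hadj (s * s),
        ← ContinuousLinearMap.mul_apply, ← map_mul, e1, e2, ← inner_neg_left,
        ← ContinuousLinearMap.neg_apply, ← map_neg]
      congr 3
      have : a * (s * s) = - (s * s * (s * s)) := by
        rw [hars, sub_mul]
        rw [show r * r * (s * s) = r * (r * s) * s by noncomm_ring, hrs]; simp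
      rw [this]
      noncomm_ring
    rw [h6, Complex.neg_re, re_inner_self] at h5
    have h7 : π (s*s*s) η = 0 := by
      have : ‖π (s*s*s) η‖ = 0 := by
        have := sq_nonneg ‖π (s*s*s) η‖
        exact pow_eq_zero_iff two_ne_zero |>.1 (by linarith)
      exact norm_eq_zero.1 this
    have h8 : ⟪π (s * s) η, π (s * s) η⟫_ℂ = ⟪π s η, π (s * s * s) η⟫_ℂ := by
      rw [hadj s |> fun h => show ⟪π s η, π (s * s * s) η⟫_ℂ = _ by
        rw [mul_assoc, map_mul π s (s * s), ContinuousLinearMap.mul_apply, h, hs.star_eq,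
          ← ContinuousLinearMap.mul_apply, ← map_mul]]
    rw [h7, inner_zero_right] at h8
    exact inner_self_eq_zero.1 h8
  have h9 : 0 ≤ (⟪ξ, π a ξ⟫_ℂ).re := by
    rw [hars, map_sub, hz, sub_zero, map_mul, ContinuousLinearMap.mul_apply, hadj, hr.star_eq,
      re_inner_self]
    positivity
  rw [hinner, ← hv, hξ] at h9
  linarith

theorem herd {B : Type} [CStarAlgebra B] (φ : B →ₗ[ℂ] ℂ)
    {H : Type} [NormedAddCommGroup H] [InnerProductSpace ℂ H] [CompleteSpace H]
    (π : B →⋆ₐ[ℂ] (H →L[ℂ] H)) (ξ : H) (hξ : ‖ξ‖ = 1) (hv : ∀ x : B, φ x = ⟪ξ, π x ξ⟫_ℂ)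
    (he : ∀ x : B, IsCompactOperator ⇑(π x) → π x = 0)
    (F : Finset B) (V : Submodule ℂ H) [FiniteDimensional ℂ V] (n : ℕ) :
    ∃ u ∈ Vᗮ, ‖u‖ ^ 2 = n ∧ ∑ x ∈ F, ‖⟪u, π x u⟫_ℂ - n * φ x‖ ^ 2 ≤
      (∑ x ∈ F, (‖π x‖ + ‖φ x‖) ^ 2 + 2) * n := by
  classical
  induction n with
  | zero => exact ⟨0, Submodule.zero_mem _, by simp, by simp⟩
  | succ n ih =>
    obtain ⟨u, hu, hun, hus⟩ := ih
    have hadj : ∀ (x : B) (u v : H), ⟪u, π x v⟫_ℂ = ⟪π (star x) u, v⟫_ℂ := by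
      intro x u v
      rw [map_star, ContinuousLinearMap.star_eq_adjoint, ContinuousLinearMap.adjoint_inner_left]
    let S : Finset H := insert u (F.image (fun x => π x u) ∪ F.image (fun x => π (star x) u))
    let V' : Submodule ℂ H := V ⊔ Submodule.span ℂ (S : Set H)
    let e : B → ℂ := fun x => ⟪u, π x u⟫_ℂ - n * φ x
    let z : B := ∑ x ∈ F, (starRingEnd ℂ) (e x) • x
    obtain ⟨η, hη, hη1, hηz⟩ := key φ π ξ hξ hv he z V' 1 one_pos
    have hS : ∀ w ∈ S, ⟪w, η⟫_ℂ = 0 := fun w hw =>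
      hη w (Submodule.mem_sup_right (Submodule.subset_span hw))
    have hV : η ∈ Vᗮ := fun w hw => hη w (Submodule.mem_sup_left hw)
    have huη : ⟪u, η⟫_ℂ = 0 := hS u (Finset.mem_insert_self _ _)
    have h1 : ∀ x ∈ F, ⟪u, π x η⟫_ℂ = 0 := by
      intro x hx
      rw [hadj]
      exact hS _ (Finset.mem_insert_of_mem (Finset.mem_union_right _ (Finset.mem_image_of_mem _ hx)))
    have h2 : ∀ x ∈ F, ⟪η, π x u⟫_ℂ = 0 := by
      intro x hx
      rw [inner_eq_zero_symm]
      exact hS _ (Finset.mem_insert_of_mem (Finset.mem_union_left _ (Finset.mem_image_of_mem _ hx)))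
    refine ⟨u + η, Submodule.add_mem _ hu hV, ?_, ?_⟩
    · have := norm_add_sq_eq_norm_sq_add_norm_sq_of_inner_eq_zero u η huη
      rw [hη1] at this
      push_cast
      nlinarith
    let d : B → ℂ := fun x => ⟪η, π x η⟫_ℂ - φ x
    have h3 : ∀ x ∈ F, ⟪u + η, π x (u + η)⟫_ℂ - ((n + 1 : ℕ) : ℂ) * φ x = e x + d x := by
      intro x hx
      simp only [map_add, inner_add_left, inner_add_right, h1 x hx, h2 x hx, e, d]
      push_cast
      ring
    rw [Finset.sum_congr rfl (fun x hx => by rw [h3 x hx])]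
    have h4 : ∀ x, ‖e x + d x‖ ^ 2 = ‖e x‖ ^ 2 + ‖d x‖ ^ 2 + 2 * ((starRingEnd ℂ) (e x) * d x).re := by
      intro x
      have := @norm_add_sq ℂ ℂ _ _ _ (e x) (d x)
      rw [this, RCLike.inner_apply', RCLike.re_eq_complex_re]
      ring
    have h5 : ∀ x, ‖d x‖ ^ 2 ≤ (‖π x‖ + ‖φ x‖) ^ 2 := by
      intro x
      have : ‖d x‖ ≤ ‖π x‖ + ‖φ x‖ := by
        refine (norm_sub_le _ _).trans (add_le_add ?_ le_rfl)
        refine (norm_inner_le_norm _ _).trans ?_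
        rw [hη1, one_mul]
        simpa [hη1] using (π x).le_opNorm η
      gcongr
    have h6 : ∑ x ∈ F, ((starRingEnd ℂ) (e x) * d x).re ≤ 1 := by
      have : ∑ x ∈ F, (starRingEnd ℂ) (e x) * d x = ⟪η, π z η⟫_ℂ - φ z := by
        simp only [z, d, map_sum, map_smul, ContinuousLinearMap.sum_apply,
          ContinuousLinearMap.smul_apply, inner_sum, inner_smul_right, mul_sub,
          Finset.sum_sub_distrib, smul_eq_mul]
      rw [← Complex.re_sum, this, Complex.sub_re]
      linarith
    simp only [h4, Finset.sum_add_distrib, ← Finset.mul_sum]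
    have h7 := Finset.sum_le_sum (fun x (_ : x ∈ F) => h5 x)
    have h8 : ∑ x ∈ F, ‖e x‖ ^ 2 ≤ (∑ x ∈ F, (‖π x‖ + ‖φ x‖) ^ 2 + 2) * n := hus
    push_cast
    linarith

theorem glimm_cstar {B : Type} [CStarAlgebra B]
    (φ : B →ₗ[ℂ] ℂ)
    (hφ_tracial : ∀ x y : B, φ (x * y) = φ (y * x))
    {H : Type} [NormedAddCommGroup H] [InnerProductSpace ℂ H] [CompleteSpace H]
    (π : B →⋆ₐ[ℂ] (H →L[ℂ] H)) (ξ : H) (hξ : ‖ξ‖ = 1) (hc : DenseRange fun b : B => π b ξ)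
    (hv : ∀ x : B, φ x = ⟪ξ, π x ξ⟫_ℂ)
    (he : ∀ x : B, IsCompactOperator ⇑(π x) → π x = 0)
    (F : Finset B) (ε : ℝ) (hε : 0 < ε) :
    ∃ b : B, φ b = 0 ∧ φ (b * star b) = 1 ∧
      ∀ x ∈ F, ‖φ (x * b)‖ < ε ∧ ‖φ (star b * x * b) - φ x‖ < ε := by
  classical
  have hadj : ∀ (x : B) (u v : H), ⟪u, π x v⟫_ℂ = ⟪π (star x) u, v⟫_ℂ := by
    intro x u v
    rw [map_star, ContinuousLinearMap.star_eq_adjoint, ContinuousLinearMap.adjoint_inner_left]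
  let S : Finset H := insert ξ (F.image (fun x => π (star x) ξ))
  set C := ∑ x ∈ F, (‖π x‖ + ‖φ x‖) ^ 2 + 2 with hC
  have hC0 : 0 < C := by positivity
  obtain ⟨n, hn⟩ := exists_nat_gt (C / ε ^ 2)
  have hn0 : (0 : ℝ) < n := lt_of_le_of_lt (by positivity) hn
  obtain ⟨u, hu, hun, hus⟩ := herd φ π ξ hξ hv he F (Submodule.span ℂ (S : Set H)) n
  have hu0 : 0 < ‖u‖ := by
    by_contra h
    have : ‖u‖ = 0 := le_antisymm (not_lt.1 h) (norm_nonneg _)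
    rw [this] at hun
    norm_num at hun
    linarith
  have hS : ∀ w ∈ S, ⟪w, u⟫_ℂ = 0 := fun w hw => hu w (Submodule.subset_span hw)
  have hξu : ⟪ξ, u⟫_ℂ = 0 := hS _ (Finset.mem_insert_self _ _)
  have hxu : ∀ x ∈ F, ⟪ξ, π x u⟫_ℂ = 0 := by
    intro x hx
    rw [hadj]
    exact hS _ (Finset.mem_insert_of_mem (Finset.mem_image_of_mem _ hx))
  have hq : ∀ x ∈ F, ‖⟪u, π x u⟫_ℂ - n * φ x‖ < ε * n := by
    intro x hx
    have h1 : ‖⟪u, π x u⟫_ℂ - n * φ x‖ ^ 2 ≤ C * n :=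
      (Finset.single_le_sum (f := fun x => ‖⟪u, π x u⟫_ℂ - n * φ x‖ ^ 2)
        (fun _ _ => by positivity) hx).trans hus
    rw [div_lt_iff₀ (by positivity)] at hn
    refine lt_of_pow_lt_pow_left₀ 2 (by positivity) (h1.trans_lt ?_)
    nlinarith
  -- the normalisation map
  let p : H → H := fun ζ => ζ - ⟪ξ, ζ⟫_ℂ • ξ
  let N : H → H := fun ζ => ((‖p ζ‖⁻¹ : ℝ) : ℂ) • p ζ
  have hpc : Continuous p := by fun_prop
  have hpu : p u = u := by simp [p, hξu]
  have hpu0 : ‖p u‖ ≠ 0 := by rw [hpu]; exact hu0.ne'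
  have hNc : ContinuousAt N u := by
    refine ContinuousAt.smul ?_ hpc.continuousAt
    exact Complex.continuous_ofReal.continuousAt.comp (hpc.norm.continuousAt.inv₀ hpu0)
  have hNu : N u = ((‖u‖⁻¹ : ℝ) : ℂ) • u := by simp only [N, hpu]
  have ev0 : ∀ᶠ ζ in nhds u, ‖p ζ‖ ≠ 0 := hpc.norm.continuousAt.eventually_ne hpu0
  have ev1 : ∀ x ∈ F, ∀ᶠ ζ in nhds u, ‖⟪ξ, π x (N ζ)⟫_ℂ‖ < ε := by
    intro x hx
    have hc1 : ContinuousAt (fun ζ => ‖⟪ξ, π x (N ζ)⟫_ℂ‖) u :=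
      (ContinuousAt.inner (𝕜 := ℂ) continuousAt_const ((π x).continuous.continuousAt.comp hNc)).norm
    refine hc1.eventually_lt continuousAt_const ?_
    rw [hNu, map_smul, inner_smul_right, hxu x hx]
    simpa using hε
  have ev2 : ∀ x ∈ F, ∀ᶠ ζ in nhds u, ‖⟪N ζ, π x (N ζ)⟫_ℂ - φ x‖ < ε := by
    intro x hx
    have hc1 : ContinuousAt (fun ζ => ‖⟪N ζ, π x (N ζ)⟫_ℂ - φ x‖) u :=
      ((ContinuousAt.inner (𝕜 := ℂ) hNc ((π x).continuous.continuousAt.comp hNc)).sub continuousAt_const).norm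
    refine hc1.eventually_lt continuousAt_const ?_
    have h1 : ⟪N u, π x (N u)⟫_ℂ - φ x = (((n : ℝ)⁻¹ : ℝ) : ℂ) * (⟪u, π x u⟫_ℂ - n * φ x) := by
      rw [hNu, map_smul, inner_smul_left, inner_smul_right, Complex.conj_ofReal, ← mul_assoc,
        ← Complex.ofReal_mul, ← mul_inv, ← sq, hun, mul_sub]
      congr 1
      have : (n : ℂ) ≠ 0 := by exact_mod_cast hn0.ne'
      push_cast
      field_simp
    rw [h1, norm_mul, Complex.norm_real, Real.norm_of_nonneg (by positivity), inv_mul_lt_iff₀ hn0,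
      mul_comm (n : ℝ) ε]
    exact hq x hx
  have ev : ∀ᶠ ζ in nhds u, ‖p ζ‖ ≠ 0 ∧ ∀ x ∈ F, ‖⟪ξ, π x (N ζ)⟫_ℂ‖ < ε ∧
      ‖⟪N ζ, π x (N ζ)⟫_ℂ - φ x‖ < ε := by
    refine ev0.and ?_
    rw [Filter.eventually_all_finset]
    exact fun x hx => (ev1 x hx).and (ev2 x hx)
  obtain ⟨U, hUsub, hUo, huU⟩ := eventually_nhds_iff.1 ev
  obtain ⟨b₀, hb₀⟩ := hc.exists_mem_open hUo ⟨u, huU⟩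
  obtain ⟨hne, hF⟩ := hUsub _ hb₀
  set ζ := π b₀ ξ with hζ
  let b : B := ((‖p ζ‖⁻¹ : ℝ) : ℂ) • (b₀ - ⟪ξ, ζ⟫_ℂ • 1)
  have hb : π b ξ = N ζ := by
    simp only [b, N, p]
    rw [map_smul, map_sub, map_smul, map_one]
    rfl
  have hstar : ∀ y : B, φ (star b * y * b) = ⟪N ζ, π y (N ζ)⟫_ℂ := by
    intro y
    rw [hv, mul_assoc, map_mul, ContinuousLinearMap.mul_apply, hadj, star_star, hb, map_mul,
      ContinuousLinearMap.mul_apply, hb]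
  refine ⟨b, ?_, ?_, ?_⟩
  · rw [hv, hb]
    simp [N, p, inner_sub_right, inner_smul_right, inner_self_eq_norm_sq_to_K, hξ]
  · rw [hφ_tracial, show star b * b = star b * 1 * b by rw [mul_one], hstar, map_one,
      ContinuousLinearMap.one_apply, inner_self_eq_norm_sq_to_K]
    have : ‖N ζ‖ = 1 := by
      simp only [N]
      rw [norm_smul, Complex.norm_real, norm_inv, norm_norm, inv_mul_cancel₀ hne]
    rw [this]; simp
  · intro x hx
    obtain ⟨h1, h2⟩ := hF x hx
    refine ⟨?_, ?_⟩
    · rw [hv, map_mul, ContinuousLinearMap.mul_apply, hb]; exact h1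
    · rw [hstar]; exact h2

/-- Glimm's lemma for GNS-essential tracial states: every finite subset `F` and `ε > 0`
admit `b ∈ ker φ` with `φ(b b*) = 1`, `|φ(x b)| < ε` and `|φ(b* x b) - φ(x)| < ε`
for all `x ∈ F`. -/
theorem glimm_lemma_tracial {B : Type} [NormedRing B] [StarRing B] [CStarRing B]
    [NormedAlgebra ℂ B] [CompleteSpace B] [StarModule ℂ B]
    (φ : B →ₗ[ℂ] ℂ) (hφ_unital : φ 1 = 1) (hφ_pos : ∀ a : B, 0 ≤ φ (star a * a))
    (hφ_tracial : ∀ x y : B, φ (x * y) = φ (y * x))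
    (hφ_ess : IsGNSEssential φ)
    (F : Finset B) (ε : ℝ) (hε : 0 < ε) :
    ∃ b : B, φ b = 0 ∧ φ (b * star b) = 1 ∧
      ∀ x ∈ F, ‖φ (x * b)‖ < ε ∧ ‖φ (star b * x * b) - φ x‖ < ε := by
  letI : CStarAlgebra B := { }
  obtain ⟨W⟩ := hφ_ess
  letI := W.normedH
  letI := W.ipsH
  letI := W.completeH
  exact glimm_cstar φ hφ_tracial W.π W.ξ W.norm_ξ W.cyclic W.vector_state W.essential F ε hε
end
end

section
/- Let B be an infinite-dimensional unital C*-algebra, H a complex Hilbert space, π : B → B(H) an injective unital star-algebra homomorphism, and ξ ∈ H a unit vector cyclic for π (i.e. π(B)ξ is dense in H); let φ be the state on B given by φ(x) = ⟨π(x)ξ, ξ⟩ (so φ is a state whose GNS representation is faithful). Then there is no constant R > 0 such that ‖a* a‖ ≤ R · φ(a* a) holds for all a ∈ B with φ(a) = 0. -/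
open scoped InnerProductSpace

noncomputable section

lemma aux_spec {B : Type} [CStarAlgebra B] (φ : B →+ ℝ) (C : ℝ) (hC : 0 < C)
    (h1 : φ 1 = 1) (h : ∀ a : B, ‖a‖ ^ 2 ≤ C * φ (star a * a))
    (x : B) (hx : IsSelfAdjoint x) : (spectrum ℝ x).Finite := by
  by_contra hinf
  obtain ⟨N, hN⟩ := exists_nat_gt C
  obtain ⟨S, hS, hcard⟩ := Set.Infinite.exists_subset_card_eq (s := spectrum ℝ x) hinf N
  obtain ⟨U, hU, hd⟩ := Set.Finite.t2_separation S.finite_toSet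
  have hf : ∀ s : ℝ, ∃ f : C(ℝ, ℝ), Set.EqOn f 0 (U s)ᶜ ∧ Set.EqOn f 1 {s} ∧
      ∀ t, f t ∈ Set.Icc (0 : ℝ) 1 := fun s =>
    exists_continuous_zero_one_of_isClosed (hU s).2.isClosed_compl isClosed_singleton
      (by simpa using (hU s).1)
  choose f hf0 hf1 hf2 using hf
  have hpos : ∀ a : B, 0 ≤ φ (star a * a) := fun a => by
    have := (sq_nonneg ‖a‖).trans (h a)
    exact nonneg_of_mul_nonneg_right this hC
  have hstar : ∀ g : ℝ → ℝ, Continuous g →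
      star (cfc g x) * cfc g x = cfc (fun t => g t * g t) x := by
    intro g hg
    rw [cfc_mul g g x hg.continuousOn hg.continuousOn, (cfc_predicate g x : IsSelfAdjoint _).star_eq]
  have hlow : ∀ s ∈ S, 1 ≤ C * φ (cfc (fun t => f s t * f s t) x) := by
    intro s hs
    rw [← hstar _ (f s).continuous]
    refine le_trans ?_ (h _)
    have hmem : (1 : ℝ) ∈ spectrum ℝ (cfc (f s) x) := by
      rw [cfc_map_spectrum (f s) x hx (f s).continuous.continuousOn]
      exact ⟨s, hS hs, hf1 s rfl⟩
    have : (1 : ℝ) ≤ ‖cfc (f s) x‖ := by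
      rcases subsingleton_or_nontrivial B with hB | hB
      · have := Subsingleton.elim (1 : B) 0
        rw [this] at h1; simp at h1
      · simpa using spectrum.norm_le_norm_of_mem hmem
    nlinarith
  have hle : ∀ t, ∑ s ∈ S, f s t * f s t ≤ 1 := by
    intro t
    by_cases ht : ∃ s ∈ S, t ∈ U s
    · obtain ⟨s, hs, hts⟩ := ht
      rw [Finset.sum_eq_single_of_mem s hs]
      · have := hf2 s t
        nlinarith [this.1, this.2]
      · intro r hr hrs
        have : t ∉ U r := fun htr => Set.disjoint_left.1 (hd hr hs hrs) htr hts
        have := hf0 r this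
        simp at this
        simp [this]
    · push Not at ht
      rw [Finset.sum_eq_zero]
      · norm_num
      · intro r hr
        have := hf0 r (ht r hr)
        simp at this
        simp [this]
  have hsum : φ (∑ s ∈ S, cfc (fun t => f s t * f s t) x) ≤ 1 := by
    have hcont : Continuous (fun t => ∑ s ∈ S, f s t * f s t) := by fun_prop
    have hg : Continuous (fun t => Real.sqrt (1 - ∑ s ∈ S, f s t * f s t)) := by fun_prop
    have h2 := hpos (cfc (fun t => Real.sqrt (1 - ∑ s ∈ S, f s t * f s t)) x)
    rw [hstar _ hg] at h2
    have h3 : (fun t => Real.sqrt (1 - ∑ s ∈ S, f s t * f s t) *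
        Real.sqrt (1 - ∑ s ∈ S, f s t * f s t)) = fun t => 1 - ∑ s ∈ S, f s t * f s t := by
      funext t
      exact Real.mul_self_sqrt (by linarith [hle t])
    rw [h3, cfc_sub (fun _ => (1 : ℝ)) _ x (by fun_prop) hcont.continuousOn, cfc_const_one ℝ x,
      map_sub, h1] at h2
    have h4 := cfc_sum (fun s t => f s t * f s t) x S (fun s _ => by fun_prop)
    have h5 : (∑ s ∈ S, fun t => f s t * f s t) = fun t => ∑ s ∈ S, f s t * f s t := by
      funext t; simp
    rw [h5] at h4
    rw [← h4]; linarith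
  rw [map_sum] at hsum
  have := Finset.sum_le_sum hlow
  rw [← Finset.mul_sum] at this
  simp [hcard] at this
  nlinarith

/-- minimal projection -/
def AuxMin {B : Type} [CStarAlgebra B] (e : B) : Prop :=
  IsSelfAdjoint e ∧ e * e = e ∧ ∀ p : B, IsSelfAdjoint p → p * p = p → e * p = p → p = 0 ∨ p = e

lemma aux_sa {B : Type} [CStarAlgebra B] 
    (hfin : ∀ x : B, IsSelfAdjoint x → (spectrum ℝ x).Finite) (e : B) (he : AuxMin e)
    (x : B) (hx : IsSelfAdjoint x) (hex : e * x = x) : ∃ c : ℝ, x = c • e := by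
  by_cases h0 : x = 0
  · exact ⟨0, by simp [h0]⟩
  have hc : ∀ g : ℝ → ℝ, ContinuousOn g (spectrum ℝ x) := fun g =>
    (hfin x hx).continuousOn g
  have hl : ∃ l ∈ spectrum ℝ x, l ≠ 0 := by
    by_contra hcon
    push Not at hcon
    apply h0
    rw [← cfc_id ℝ x hx, cfc_congr (f := id) (g := fun _ => (0:ℝ)) (fun t ht => hcon t ht)]
    simp
  obtain ⟨l, hl, hl0⟩ := hl
  classical
  let d : ℝ → ℝ := fun t => if t = l then 1 else 0
  have hp : e * cfc d x = cfc d x := by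
    have : cfc d x = x * cfc (fun t => l⁻¹ * d t) x := by
      conv_rhs => enter [1]; rw [← cfc_id ℝ x hx]
      rw [← cfc_mul id _ x (hc _) (hc _)]
      congr 1; funext t
      by_cases ht : t = l <;> simp [d, ht, hl0]
    rw [this, ← mul_assoc, hex]
  have hpp : cfc d x * cfc d x = cfc d x := by
    rw [← cfc_mul d d x (hc _) (hc _)]
    congr 1; funext t; simp [d]
  have hxp : x * cfc d x = l • cfc d x := by
    conv_lhs => enter [1]; rw [← cfc_id ℝ x hx]
    rw [← cfc_mul id _ x (hc _) (hc _), ← cfc_smul l d x (hc _)]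
    congr 1; funext t
    by_cases ht : t = l <;> simp [d, ht]
  have hxe : x * e = x := by
    have := congrArg star hex
    rwa [star_mul, hx.star_eq, he.1.star_eq] at this
  have hne : cfc d x ≠ 0 := by
    intro h
    have hmem : (1 : ℝ) ∈ spectrum ℝ (cfc d x) := by
      rw [cfc_map_spectrum d x hx (hc _)]
      exact ⟨l, hl, by simp [d]⟩
    have hB : Nontrivial B := ⟨x, 0, h0⟩
    rw [h, spectrum.zero_eq] at hmem
    simp at hmem
  rcases he.2.2 _ (cfc_predicate d x) hpp hp with h | h
  · exact absurd h hne
  · exact ⟨l, by rw [h, hxe] at hxp; exact hxp⟩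

lemma aux_gen {B : Type} [CStarAlgebra B] 
    (hfin : ∀ x : B, IsSelfAdjoint x → (spectrum ℝ x).Finite) (e : B) (he : AuxMin e)
    (x : B) (hex : e * x = x) (hxe : x * e = x) : ∃ c : ℂ, x = c • e := by
  have hse : star x * e = star x := by
    have := congrArg star hex
    rwa [star_mul, he.1.star_eq] at this
  have hes : e * star x = star x := by
    have := congrArg star hxe
    rwa [star_mul, he.1.star_eq] at this
  obtain ⟨a, ha⟩ := aux_sa hfin e he (realPart x : B) (realPart x).2 (by
    rw [realPart_apply_coe, mul_smul_comm, mul_add, hex, hes])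
  obtain ⟨b, hb⟩ := aux_sa hfin e he (imaginaryPart x : B) (imaginaryPart x).2 (by
    rw [imaginaryPart_apply_coe, mul_smul_comm, mul_smul_comm, mul_sub, hex, hes])
  refine ⟨a + Complex.I * b, ?_⟩
  rw [← realPart_add_I_smul_imaginaryPart x, ha, hb, add_smul, mul_smul]
  simp

/-- corner map -/
def auxT {B : Type} [CStarAlgebra B] (e f : B) : B →ₗ[ℂ] B :=
  LinearMap.mulLeft ℂ e ∘ₗ LinearMap.mulRight ℂ f

lemma aux_corner {B : Type} [CStarAlgebra B] 
    (hfin : ∀ x : B, IsSelfAdjoint x → (spectrum ℝ x).Finite) (e f : B) (he : AuxMin e)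
    (hf : AuxMin f) : FiniteDimensional ℂ (LinearMap.range (auxT e f)) := by
  by_cases h0 : ∀ b, e * (b * f) = 0
  · have : auxT e f = 0 := by ext b; simpa [auxT] using h0 b
    rw [this, LinearMap.range_zero]; infer_instance
  push Not at h0
  obtain ⟨b, hb⟩ := h0
  set x := e * (b * f) with hxdef
  have hex : e * x = x := by rw [hxdef, ← mul_assoc, he.2.1]
  have hxf : x * f = x := by rw [hxdef, mul_assoc, mul_assoc, hf.2.1]
  have hsx : f * star x = star x := by
    have := congrArg star hxf
    rwa [star_mul, hf.1.star_eq] at this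
  have hse : star x * e = star x := by
    have := congrArg star hex
    rwa [star_mul, he.1.star_eq] at this
  obtain ⟨l, hl⟩ := aux_gen hfin f hf (star x * x) (by rw [← mul_assoc, hsx])
    (by rw [mul_assoc, hxf])
  have hl0 : l ≠ 0 := by
    rintro rfl
    rw [zero_smul] at hl
    exact hb (CStarRing.star_mul_self_eq_zero_iff x |>.1 hl)
  have hle : LinearMap.range (auxT e f) ≤ Submodule.span ℂ {x} := by
    rintro _ ⟨c, rfl⟩
    have hy : auxT e f c = e * (c * f) := rfl
    set y := auxT e f c
    have hey : e * y = y := by rw [hy, ← mul_assoc, he.2.1]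
    have hyf : y * f = y := by rw [hy, mul_assoc, mul_assoc, hf.2.1]
    obtain ⟨m, hm⟩ := aux_gen hfin e he (y * star x) (by rw [← mul_assoc, hey])
      (by rw [mul_assoc, hse])
    rw [Submodule.mem_span_singleton]
    refine ⟨l⁻¹ * m, ?_⟩
    have h1 : l • y = m • x := by
      calc l • y = y * (l • f) := by rw [mul_smul_comm, hyf]
        _ = (y * star x) * x := by rw [← hl, mul_assoc]
        _ = m • x := by rw [hm, smul_mul_assoc, hex]
    rw [mul_smul, ← h1, smul_smul, inv_mul_cancel₀ hl0, one_smul]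
  exact Submodule.finiteDimensional_of_le hle

lemma aux_fd_add {B : Type} [CStarAlgebra B] (S T : B →ₗ[ℂ] B)
    (hS : FiniteDimensional ℂ (LinearMap.range S)) (hT : FiniteDimensional ℂ (LinearMap.range T)) :
    FiniteDimensional ℂ (LinearMap.range (S + T)) :=
  Submodule.finiteDimensional_of_le (LinearMap.range_add_le S T)

lemma aux_main {B : Type} [CStarAlgebra B] (φ : B →+ ℝ) (C : ℝ) (hC : 0 < C)
    (h1 : φ 1 = 1) (h : ∀ a : B, ‖a‖ ^ 2 ≤ C * φ (star a * a)) : FiniteDimensional ℂ B := by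
  have hfin := aux_spec φ C hC h1 h
  have hlow : ∀ p : B, IsSelfAdjoint p → p * p = p → p ≠ 0 → 1 ≤ C * φ p := by
    intro p hp hpp hp0
    have h2 := h p
    rw [hp.star_eq, hpp] at h2
    have h3 : ‖p‖ = ‖p‖ * ‖p‖ := by
      conv_lhs => rw [← hpp]
      nth_rewrite 1 [← hp.star_eq]
      exact CStarRing.norm_star_mul_self
    have h4 : ‖p‖ = 1 := by
      have : ‖p‖ ≠ 0 := norm_ne_zero_iff.2 hp0
      field_simp at h3
      exact h3.symm
    rw [h4] at h2; linarith
  have key : ∀ n : ℕ, ∀ p : B, IsSelfAdjoint p → p * p = p → C * φ p < n →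
      p ∈ AddSubmonoid.closure {e : B | AuxMin e} := by
    intro n
    induction n with
    | zero =>
      intro p hp hpp hlt
      by_cases hp0 : p = 0
      · rw [hp0]; exact zero_mem _
      · have := hlow p hp hpp hp0
        simp at hlt
        linarith
    | succ n ih =>
      intro p hp hpp hlt
      push_cast at hlt
      by_cases hmin : AuxMin p
      · exact AddSubmonoid.subset_closure hmin
      · simp only [AuxMin, hp, hpp, true_and] at hmin
        push Not at hmin
        obtain ⟨q, hq, hqq, hpq, hq0, hqp⟩ := hmin
        have hqp' : q * p = q := by
          have := congrArg star hpq
          rwa [star_mul, hp.star_eq, hq.star_eq] at this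
        have hr : IsSelfAdjoint (p - q) := hp.sub hq
        have hrr : (p - q) * (p - q) = p - q := by
          rw [mul_sub, sub_mul, sub_mul, hpp, hqq, hpq, hqp']; simp
        have h5 := hlow q hq hqq hq0
        have h6 := hlow _ hr hrr (sub_ne_zero.2 (Ne.symm hqp))
        rw [map_sub] at h6
        have h7 : p = q + (p - q) := by abel
        rw [h7]
        refine add_mem (ih q hq hqq ?_) (ih _ hr hrr ?_)
        · linarith
        · rw [map_sub]; linarith
  obtain ⟨N, hN⟩ := exists_nat_gt (C * φ 1)
  have h1mem := key N 1 (IsSelfAdjoint.one B) (one_mul 1) hN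
  have hA : ∀ e : B, AuxMin e → FiniteDimensional ℂ (LinearMap.range (auxT e 1)) := by
    intro e he
    refine AddSubmonoid.closure_induction
      (motive := fun f _ => FiniteDimensional ℂ (LinearMap.range (auxT e f))) ?_ ?_ ?_ h1mem
    · intro f hf; exact aux_corner hfin e f he hf
    · have : auxT e 0 = 0 := by ext b; simp [auxT]
      rw [this, LinearMap.range_zero]; infer_instance
    · intro f g _ _ hf hg
      have : auxT e (f + g) = auxT e f + auxT e g := by ext b; simp [auxT, mul_add]
      rw [this]; exact aux_fd_add _ _ hf hg
  have hB : FiniteDimensional ℂ (LinearMap.range (auxT (1 : B) 1)) := by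
    refine AddSubmonoid.closure_induction
      (motive := fun f _ => FiniteDimensional ℂ (LinearMap.range (auxT f 1))) ?_ ?_ ?_ h1mem
    · intro f hf; exact hA f hf
    · have : auxT (0 : B) 1 = 0 := by ext b; simp [auxT]
      rw [this, LinearMap.range_zero]; infer_instance
    · intro f g _ _ hf hg
      have : auxT (f + g) 1 = auxT f 1 + auxT g 1 := by ext b; simp [auxT, add_mul]
      rw [this]; exact aux_fd_add _ _ hf hg
  have hid : auxT (1 : B) 1 = LinearMap.id := by ext b; simp [auxT]
  rw [hid, LinearMap.range_id] at hB
  exact Module.finite_def.2 ((Submodule.fg_top _).1 (Module.finite_def.1 hB))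

/-- Let `B` be an infinite-dimensional unital C*-algebra and `φ` a state on `B` with
faithful GNS representation, realized as the vector state of an injective unital
star-representation `π` on a Hilbert space `H` with cyclic unit vector `ξ`. Then there
is no constant `R > 0` with `‖a* a‖ ≤ R φ(a* a)` for all `a ∈ ker φ`. -/
theorem no_bounded_below_constant {B : Type} [NormedRing B] [StarRing B] [CStarRing B]
    [NormedAlgebra ℂ B] [CompleteSpace B] [StarModule ℂ B]
    (hB_infdim : ¬ FiniteDimensional ℂ B)
    {H : Type} [NormedAddCommGroup H] [InnerProductSpace ℂ H] [CompleteSpace H]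
    (π : B →⋆ₐ[ℂ] (H →L[ℂ] H)) (hπ_inj : Function.Injective π)
    (ξ : H) (hξ : ‖ξ‖ = 1) (hcyclic : DenseRange fun b : B => π b ξ)
    (φ : B → ℂ) (hφ : ∀ x : B, φ x = ⟪ξ, π x ξ⟫_ℂ) :
    ¬ ∃ R : ℝ, 0 < R ∧ ∀ a : B, φ a = 0 → ‖star a * a‖ ≤ R * (φ (star a * a)).re := by
  rintro ⟨R, hR, hbd⟩
  apply hB_infdim
  letI : CStarAlgebra B := {}
  let ψ : B →+ ℝ :=
    { toFun := fun a => (⟪ξ, π a ξ⟫_ℂ).re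
      map_zero' := by simp
      map_add' := fun a b => by simp [inner_add_right] }
  have hinner : ∀ a : B, ⟪ξ, π (star a * a) ξ⟫_ℂ = ((‖π a ξ‖ ^ 2 : ℝ) : ℂ) := by
    intro a
    rw [map_mul, map_star, ContinuousLinearMap.star_eq_adjoint, ContinuousLinearMap.mul_apply,
      ContinuousLinearMap.adjoint_inner_right, inner_self_eq_norm_sq_to_K]
    simp
  have hψ : ∀ a : B, ψ (star a * a) = ‖π a ξ‖ ^ 2 := by
    intro a
    change (⟪ξ, π (star a * a) ξ⟫_ℂ).re = _
    rw [hinner, Complex.ofReal_re]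
  have hξξ : ⟪ξ, ξ⟫_ℂ = 1 := by rw [inner_self_eq_norm_sq_to_K, hξ]; simp
  have h1 : ψ 1 = 1 := by
    change (⟪ξ, π 1 ξ⟫_ℂ).re = _
    simp [hξ]
  haveI : Nontrivial B := by
    refine ⟨1, 0, fun h => ?_⟩
    rw [h, map_zero] at h1
    norm_num at h1
  refine aux_main ψ (2 + 2 * R * 4) (by positivity) h1 ?_
  intro a
  rw [hψ]
  set c : ℂ := ⟪ξ, π a ξ⟫_ℂ with hc
  set a0 : B := a - algebraMap ℂ B c with ha0
  have hπ0 : π a0 ξ = π a ξ - c • ξ := by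
    rw [ha0, map_sub, AlgHomClass.commutes]
    simp [Algebra.algebraMap_eq_smul_one]
  have hφ0 : φ a0 = 0 := by
    rw [hφ, hπ0, inner_sub_right, inner_smul_right, hξξ, ← hc]; simp
  have hb := hbd a0 hφ0
  rw [hφ, hinner, Complex.ofReal_re, CStarRing.norm_star_mul_self] at hb
  have hcle : ‖c‖ ≤ ‖π a ξ‖ := by
    have := norm_inner_le_norm (𝕜 := ℂ) ξ (π a ξ)
    rwa [hξ, one_mul] at this
  have hn0 : ‖π a0 ξ‖ ≤ 2 * ‖π a ξ‖ := by
    rw [hπ0]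
    refine (norm_sub_le _ _).trans ?_
    rw [norm_smul, hξ]; linarith
  have hna : ‖a‖ ≤ ‖a0‖ + ‖c‖ := by
    have : a = a0 + algebraMap ℂ B c := by rw [ha0]; abel
    conv_lhs => rw [this]
    refine (norm_add_le _ _).trans ?_
    rw [norm_algebraMap' B c]
  have e1 : ‖π a0 ξ‖ ^ 2 ≤ 4 * ‖π a ξ‖ ^ 2 := by
    have := pow_le_pow_left₀ (norm_nonneg _) hn0 2
    linarith
  have e2 : ‖c‖ ^ 2 ≤ ‖π a ξ‖ ^ 2 := pow_le_pow_left₀ (norm_nonneg _) hcle 2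
  have e3 : ‖a‖ ^ 2 ≤ (‖a0‖ + ‖c‖) ^ 2 := pow_le_pow_left₀ (norm_nonneg _) hna 2
  have e4 := mul_le_mul_of_nonneg_left e1 hR.le
  nlinarith [sq_nonneg (‖a0‖ - ‖c‖)]
end
end

section
/- Let B be a unital C*-algebra and φ a faithful state on B (i.e. φ(a* a) = 0 implies a = 0). Assume that B contains no non-zero projection p such that p B p = ℂ p. Then for every finite subset F of B and every ε > 0 there exists a positive element b ∈ B such that |φ(a b)| < ε and |φ(b a b) − φ(a)| < ε for all a ∈ F. (Equivalently, there is a net (b_i) of positive elements of B with lim_i φ(a b_i) = 0 and lim_i φ(b_i a b_i) = φ(a) for every a ∈ B.) -/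
open scoped ComplexOrder

noncomputable section

section Aux
variable {B : Type} [CStarAlgebra B]

lemma split1 (h : B) (hh : IsSelfAdjoint h) (H : ¬ ∃ r : ℝ, h * h = r • h) :
    ∃ k l : B, IsSelfAdjoint k ∧ IsSelfAdjoint l ∧ h * k * h ≠ 0 ∧ h * l * h ≠ 0 ∧
      (h * k * h) * (h * l * h) = 0 := by
  have h1 : ∃ s ∈ spectrum ℝ h, ∃ t ∈ spectrum ℝ h, s ≠ 0 ∧ t ≠ 0 ∧ s ≠ t := by
    by_contra hc
    push Not at hc
    apply H
    by_cases hs : ∃ s ∈ spectrum ℝ h, s ≠ 0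
    · obtain ⟨s, hs, hs0⟩ := hs
      refine ⟨s, ?_⟩
      have e1 : h * h = cfc (fun x : ℝ => x * x) h := by
        rw [cfc_mul (fun x : ℝ => x) (fun x : ℝ => x) h, cfc_id' ℝ h]
      have e2 : s • h = cfc (fun x : ℝ => s * x) h := by
        rw [cfc_const_mul_id s h]
      rw [e1, e2]
      apply cfc_congr
      intro x hx
      by_cases hx0 : x = 0
      · simp [hx0]
      · have := hc s hs x hx hs0 hx0
        simp [this]
    · push Not at hs
      refine ⟨0, ?_⟩
      have e1 : h * h = cfc (fun x : ℝ => x * x) h := by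
        rw [cfc_mul (fun x : ℝ => x) (fun x : ℝ => x) h, cfc_id' ℝ h]
      rw [e1, zero_smul, ← cfc_zero ℝ h]
      apply cfc_congr
      intro x hx
      simp [hs x hx]
  obtain ⟨s, hs, t, ht, hs0, ht0, hst⟩ := h1
  have key : ∀ k : ℝ → ℝ, Continuous k → h * cfc k h * h = cfc (fun x => x * k x * x) h := by
    intro k hk
    rw [cfc_mul (fun x : ℝ => x * k x) (fun x : ℝ => x) h, cfc_mul (fun x : ℝ => x) k h,
      cfc_id' ℝ h]
  have nz : ∀ k : ℝ → ℝ, Continuous k → ∀ x ∈ spectrum ℝ h, x ≠ 0 → k x ≠ 0 →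
      h * cfc k h * h ≠ 0 := by
    intro k hk x hx hx0 hkx h0
    rw [key k hk, ← cfc_zero ℝ h, cfc_eq_cfc_iff_eqOn] at h0
    have := h0 hx
    simp [hx0, hkx] at this
  have hd : 0 < |s - t| / 2 := by have := abs_pos.2 (sub_ne_zero.2 hst); linarith
  let k : ℝ → ℝ := fun x => max 0 (|s - t| / 2 - |x - s|)
  let l : ℝ → ℝ := fun x => max 0 (|s - t| / 2 - |x - t|)
  have ck : Continuous k := by fun_prop
  have cl : Continuous l := by fun_prop
  refine ⟨cfc k h, cfc l h, cfc_predicate _ _, cfc_predicate _ _,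
    nz k ck s hs hs0 ?_, nz l cl t ht ht0 ?_, ?_⟩
  · simp only [k, sub_self, abs_zero, sub_zero]; rw [max_eq_right hd.le]; exact hd.ne'
  · simp only [l, sub_self, abs_zero, sub_zero]; rw [max_eq_right hd.le]; exact hd.ne'
  · rw [key k ck, key l cl, ← cfc_mul (fun x => x * k x * x) (fun x => x * l x * x) h,
      ← cfc_zero ℝ h]
    apply cfc_congr
    intro x hx
    have : k x = 0 ∨ l x = 0 := by
      simp only [k, l]
      by_contra hc
      push Not at hc
      have h1 := (lt_max_iff.1 (lt_of_le_of_ne (le_max_left _ _) hc.1.symm)).resolve_left (lt_irrefl _)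
      have h2 := (lt_max_iff.1 (lt_of_le_of_ne (le_max_left _ _) hc.2.symm)).resolve_left (lt_irrefl _)
      have h3 := abs_sub_le s x t
      rw [abs_sub_comm s x] at h3
      linarith
    rcases this with h | h <;> simp [h]

/-- `B` has no minimal projections -/
def NoMin (B : Type) [CStarAlgebra B] : Prop := ¬ ∃ p : B, p ≠ 0 ∧ star p = p ∧ p * p = p ∧
      ∀ x : B, ∃ c : ℂ, p * x * p = c • p

lemma exists_h (hB : NoMin B) (e : B) (he : IsSelfAdjoint e) (he0 : e ≠ 0) :
    ∃ w : B, IsSelfAdjoint w ∧ ¬ ∃ r : ℝ, (e * w * e) * (e * w * e) = r • (e * w * e) := by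
  by_contra hc
  push Not at hc
  apply hB
  have hee : e * e ≠ 0 := by
    intro h
    apply he0
    rw [← CStarRing.star_mul_self_eq_zero_iff, he.star_eq, h]
  have heeee : (e * e) * (e * e) ≠ 0 := by
    intro h
    apply hee
    rw [← CStarRing.star_mul_self_eq_zero_iff, star_mul, he.star_eq, h]
  obtain ⟨r, hr⟩ := hc 1 (IsSelfAdjoint.one B)
  rw [mul_one] at hr
  have hr0 : r ≠ 0 := by
    rintro rfl
    rw [zero_smul] at hr
    exact heeee hr
  obtain ⟨p, hp⟩ : ∃ p, p = r⁻¹ • (e * e) := ⟨_, rfl⟩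
  have hp0 : p ≠ 0 := by rw [hp]; exact smul_ne_zero (inv_ne_zero hr0) hee
  have hps : star p = p := by rw [hp]; simp [he.star_eq]
  have hpp : p * p = p := by
    rw [hp, smul_mul_smul_comm, hr, smul_smul]
    congr 1; field_simp
  have hP : ∀ h : B, IsSelfAdjoint h → p * h * p = h → ∃ r : ℝ, h * h = r • h := by
    intro h hh hph
    obtain ⟨s, hs⟩ := hc (r⁻¹ • r⁻¹ • (e * h * e)) (by
      rw [IsSelfAdjoint]; simp [he.star_eq, hh.star_eq, mul_assoc])
    have : e * (r⁻¹ • r⁻¹ • (e * h * e)) * e = h := by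
      rw [← hph, hp]
      simp only [mul_smul_comm, smul_mul_assoc, mul_assoc]
      have h2 : e * (e * (e * (e * (h * (e * (e * (e * e))))))) =
         (r * r) • (e * (e * (h * (e * e)))) := by
        calc _ = ((e * e) * (e * e)) * h * ((e * e) * (e * e)) := by simp only [mul_assoc]
          _ = _ := by rw [hr]; simp only [mul_smul_comm, smul_mul_assoc, mul_assoc, smul_smul]
      rw [h2]
      simp only [smul_smul]
      congr 1
      field_simp
    rw [this] at hs
    exact ⟨s, hs⟩
  have hsa : ∀ h : B, IsSelfAdjoint h → p * h * p = h → ∃ c : ℝ, h = c • p := by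
    intro h hh hph
    have ph : p * h = h := by rw [← hph, ← mul_assoc, ← mul_assoc, hpp]
    have hp' : h * p = h := by rw [← hph, mul_assoc, hpp]
    obtain ⟨a, ha⟩ := hP h hh hph
    have hpsa : IsSelfAdjoint p := hps
    obtain ⟨b, hb⟩ := hP (p + h) (hpsa.add hh) (by rw [mul_add, add_mul, hph, hpp, hpp])
    obtain ⟨c, hc⟩ := hP (p - h) (hpsa.sub hh) (by rw [mul_sub, sub_mul, hph, hpp, hpp])
    have e1 : (2 + a - b) • h = (b - 1) • p := by
      simp only [mul_add, add_mul, hpp, ph, hp', ha] at hb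
      have hb' := sub_eq_zero.2 hb
      rw [← sub_eq_zero, ← hb']
      module
    have e2 : (c + a - 2) • h = (c - 1) • p := by
      simp only [mul_sub, sub_mul, hpp, ph, hp', ha] at hc
      have hc' := sub_eq_zero.2 hc
      rw [← sub_eq_zero, ← hc']
      module
    by_cases h1 : 2 + a - b = 0
    · by_cases h2 : c + a - 2 = 0
      · rw [h1, zero_smul] at e1
        rw [h2, zero_smul] at e2
        have := (smul_eq_zero.1 e1.symm).resolve_right hp0
        have := (smul_eq_zero.1 e2.symm).resolve_right hp0
        exfalso; linarith
      · refine ⟨(c + a - 2)⁻¹ * (c - 1), ?_⟩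
        rw [mul_smul, ← e2, smul_smul, inv_mul_cancel₀ h2, one_smul]
    · refine ⟨(2 + a - b)⁻¹ * (b - 1), ?_⟩
      rw [mul_smul, ← e1, smul_smul, inv_mul_cancel₀ h1, one_smul]
  refine ⟨p, hp0, hps, hpp, fun x => ?_⟩
  have aux : ∀ y : B, IsSelfAdjoint y → ∃ c : ℝ, p * y * p = c • p := by
    intro y hy
    apply hsa
    · rw [IsSelfAdjoint]; simp [hps, hy.star_eq, mul_assoc]
    · simp only [← mul_assoc, hpp]; simp only [mul_assoc, hpp]
  obtain ⟨c, hc⟩ := aux (realPart x) (realPart x).2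
  obtain ⟨d, hd⟩ := aux (imaginaryPart x) (imaginaryPart x).2
  refine ⟨c + Complex.I * d, ?_⟩
  conv_lhs => rw [← realPart_add_I_smul_imaginaryPart x]
  rw [mul_add, add_mul, hc, mul_smul_comm, smul_mul_assoc, hd, add_smul, mul_smul]
  simp only [Complex.coe_smul]

lemma split2 (hB : NoMin B) (e : B) (he : IsSelfAdjoint e) (he0 : e ≠ 0) :
    ∃ k l : B, IsSelfAdjoint (e * k * e) ∧ IsSelfAdjoint (e * l * e) ∧ e * k * e ≠ 0 ∧
      e * l * e ≠ 0 ∧ (e * k * e) * (e * l * e) = 0 := by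
  obtain ⟨w, hw, H⟩ := exists_h hB e he he0
  have hs : IsSelfAdjoint (e * w * e) := by
    rw [IsSelfAdjoint]; simp [he.star_eq, hw.star_eq, mul_assoc]
  obtain ⟨k, l, hk, hl, h1, h2, h3⟩ := split1 _ hs H
  have hh : ∀ k, e * (w * e * k * e * w) * e = (e * w * e) * k * (e * w * e) := by
    intro k; simp only [mul_assoc]
  refine ⟨w * e * k * e * w, w * e * l * e * w, ?_, ?_, ?_, ?_, ?_⟩
  · rw [hh, IsSelfAdjoint, star_mul _ (e * w * e), star_mul _ k, hs.star_eq, hk.star_eq, ← mul_assoc]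
  · rw [hh, IsSelfAdjoint, star_mul _ (e * w * e), star_mul _ l, hs.star_eq, hl.star_eq, ← mul_assoc]
  · rwa [hh]
  · rwa [hh]
  · rwa [hh, hh]

lemma exists_seq (hB : NoMin B) (N : ℕ) : ∀ (e : B) (he : IsSelfAdjoint e) (he0 : e ≠ 0),
    ∃ x : Fin N → B, (∀ i, ∃ w, x i = e * w * e) ∧ (∀ i, IsSelfAdjoint (x i)) ∧
      (∀ i, x i ≠ 0) ∧ ∀ i j, i ≠ j → x i * x j = 0 := by
  induction N with
  | zero => intro e _ _; exact ⟨fun _ => 0, fun i => i.elim0, fun i => i.elim0, fun i => i.elim0,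
      fun i => i.elim0⟩
  | succ n ih =>
    intro e he he0
    obtain ⟨k, l, hk, hl, hk0, hl0, hkl⟩ := split2 hB e he he0
    have hlk : (e * l * e) * (e * k * e) = 0 := by
      have := congrArg star hkl
      rwa [star_mul, hk.star_eq, hl.star_eq, star_zero] at this
    obtain ⟨x, hx1, hx2, hx3, hx4⟩ := ih _ hl hl0
    refine ⟨Fin.cons (e * k * e) x, ?_, ?_, ?_, ?_⟩
    · intro i
      refine Fin.cases ⟨k, rfl⟩ (fun i => ?_) i
      obtain ⟨w, hw⟩ := hx1 i
      exact ⟨l * e * w * e * l, by rw [Fin.cons_succ, hw]; simp only [mul_assoc]⟩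
    · intro i; exact Fin.cases hk hx2 i
    · intro i; exact Fin.cases hk0 hx3 i
    · intro i j
      refine Fin.cases (fun hij => ?_) (fun i hij => ?_) i
      · revert hij
        refine Fin.cases (fun h => absurd rfl h) (fun j _ => ?_) j
        obtain ⟨w, hw⟩ := hx1 j
        rw [Fin.cons_zero, Fin.cons_succ, hw, mul_assoc (e * l * e), ← mul_assoc (e * k * e), hkl, zero_mul]
      · revert hij
        refine Fin.cases (fun _ => ?_) (fun j hij => ?_) j
        · obtain ⟨w, hw⟩ := hx1 i
          rw [Fin.cons_zero, Fin.cons_succ, hw, mul_assoc, hlk, mul_zero]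
        · rw [Fin.cons_succ, Fin.cons_succ]
          exact hx4 i j (fun h => hij (by rw [h]))

section
variable (φ : B →ₗ[ℂ] ℂ)

lemma phi_star (hpos : ∀ a : B, 0 ≤ φ (star a * a)) (x : B) : φ (star x) = star (φ x) := by
  have im0 : ∀ a, (φ (star a * a)).im = 0 := fun a => ((Complex.nonneg_iff.1 (hpos a)).2).symm
  have h0 := im0 1
  have hx := im0 x
  have h1 := im0 (x + 1)
  have h2 := im0 (Complex.I • x + 1)
  simp only [star_add, star_one, mul_add, add_mul, one_mul, mul_one, map_add, Complex.add_im,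
    star_smul, smul_mul_assoc, mul_smul_comm, map_smul, smul_eq_mul] at h0 hx h1 h2
  simp at h0 hx h1 h2
  apply Complex.ext
  · simp; linarith
  · simp; linarith

lemma bessel (hpos : ∀ a : B, 0 ≤ φ (star a * a)) (N : ℕ) (b : Fin N → B)
    (hb : ∀ i, star (b i) = b i) (h1 : ∀ i, φ (b i * b i) = 1)
    (h0 : ∀ i j, i ≠ j → b i * b j = 0) (g : B) :
    ∑ i, ‖φ (g * b i)‖ ^ 2 ≤ (φ (g * star g)).re := by
  have key := hpos (star g - ∑ i, star (φ (g * b i)) • b i)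
  have hc : ∀ i, φ (b i * star g) = star (φ (g * b i)) := by
    intro i; rw [← phi_star φ hpos, star_mul, hb]
  have e : φ (star (star g - ∑ i, star (φ (g * b i)) • b i) *
      (star g - ∑ i, star (φ (g * b i)) • b i)) =
      φ (g * star g) - ∑ i, φ (g * b i) * star (φ (g * b i)) := by
    have hd : (∑ i, φ (g * b i) • b i) * (∑ i, star (φ (g * b i)) • b i) =
        ∑ i, (φ (g * b i) * star (φ (g * b i))) • (b i * b i) := by
      rw [Finset.sum_mul_sum]
      apply Finset.sum_congr rfl
      intro i _
      rw [Finset.sum_eq_single i]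
      · rw [smul_mul_smul_comm]
      · intro j _ hj
        rw [smul_mul_smul_comm, h0 i j hj.symm, smul_zero]
      · simp
    simp only [star_sub, star_star, star_sum, star_smul, hb, mul_sub, sub_mul, hd]
    simp only [map_sub, map_sum, map_smul, Finset.mul_sum, Finset.sum_mul, mul_smul_comm,
      smul_mul_assoc, smul_eq_mul, hc, h1, mul_one]
    have : ∑ i, star (φ (g * b i)) * φ (g * b i) = ∑ i, φ (g * b i) * star (φ (g * b i)) :=
      Finset.sum_congr rfl fun i _ => mul_comm _ _
    rw [this]
    ring
  rw [e] at key
  have := (Complex.nonneg_iff.1 key).1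
  have e2 : ∀ z : ℂ, (z * star z) = ((‖z‖ ^ 2 : ℝ) : ℂ) := by
    intro z
    rw [Complex.star_def, Complex.mul_conj, Complex.normSq_eq_norm_sq]
  simp only [e2] at this
  rw [← Complex.ofReal_sum, Complex.sub_re, Complex.ofReal_re] at this
  linarith

lemma exists_orth (hpos : ∀ a : B, 0 ≤ φ (star a * a))
    (hf : ∀ a : B, φ (star a * a) = 0 → a = 0) (hB : NoMin B)
    (e : B) (he : IsSelfAdjoint e) (he0 : e ≠ 0) (G : Finset B) (ε : ℝ) (hε : 0 < ε) :
    ∃ b v : B, b = e * v ∧ (∃ c : B, b = star c * c) ∧ φ (b * b) = 1 ∧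
      ∀ g ∈ G, ‖φ (g * b)‖ < ε := by
  obtain ⟨N, hN⟩ := exists_nat_gt ((∑ g ∈ G, (φ (g * star g)).re) / ε ^ 2)
  have hN' : (∑ g ∈ G, (φ (g * star g)).re) < N * ε ^ 2 := (div_lt_iff₀ (by positivity)).1 hN
  obtain ⟨x, hx1, hx2, hx3, hx4⟩ := exists_seq hB N e he he0
  have hx2' : ∀ i, star (x i) = x i := hx2
  have hxx : ∀ i, x i * x i ≠ 0 := by
    intro i h
    apply hx3 i
    rw [← CStarRing.star_mul_self_eq_zero_iff, hx2', h]
  have hr : ∀ i, ∃ r : ℝ, 0 < r ∧ φ ((x i * x i) * (x i * x i)) = r := by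
    intro i
    have h1 := hpos (x i * x i)
    have h2 := mt (hf (x i * x i)) (hxx i)
    rw [star_mul, hx2'] at h1 h2
    have h3 := Complex.nonneg_iff.1 h1
    refine ⟨(φ ((x i * x i) * (x i * x i))).re, lt_of_le_of_ne h3.1 ?_, ?_⟩
    · intro h
      exact h2 (Complex.ext h.symm h3.2.symm)
    · exact Complex.ext (by simp) (by simpa using h3.2.symm)
  choose r hr0 hr using hr
  let s : Fin N → ℝ := fun i => Real.sqrt (Real.sqrt (r i))⁻¹
  let b : Fin N → B := fun i => star ((s i : ℂ) • x i) * ((s i : ℂ) • x i)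
  have hss : ∀ i, (s i * s i) * (s i * s i) * r i = 1 := by
    intro i
    simp only [s]
    rw [Real.mul_self_sqrt (by positivity), ← mul_inv, Real.mul_self_sqrt (hr0 i).le]
    exact inv_mul_cancel₀ (hr0 i).ne'
  have hb : ∀ i, b i = ((s i * s i : ℝ) : ℂ) • (x i * x i) := by
    intro i
    simp only [b, star_smul, hx2', smul_mul_smul_comm]
    simp
  have hb1 : ∀ i, φ (b i * b i) = 1 := by
    intro i
    rw [hb, smul_mul_smul_comm, map_smul, hr, smul_eq_mul]
    exact_mod_cast hss i
  have hbs : ∀ i, star (b i) = b i := by intro i; simp [b]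
  have hb0 : ∀ i j, i ≠ j → b i * b j = 0 := by
    intro i j hij
    rw [hb, hb, smul_mul_smul_comm, mul_assoc, ← mul_assoc (x i) (x j), hx4 i j hij, zero_mul,
      mul_zero, smul_zero]
  have : ∃ i, ∀ g ∈ G, ‖φ (g * b i)‖ < ε := by
    by_contra hc
    push Not at hc
    have h1 : ∑ i : Fin N, ε ^ 2 ≤ ∑ i, ∑ g ∈ G, ‖φ (g * b i)‖ ^ 2 := by
      apply Finset.sum_le_sum
      intro i _
      obtain ⟨g, hg, hgi⟩ := hc i
      calc ε ^ 2 ≤ ‖φ (g * b i)‖ ^ 2 := by gcongr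
        _ ≤ _ := Finset.single_le_sum (f := fun g => ‖φ (g * b i)‖ ^ 2)
              (fun _ _ => by positivity) hg
    rw [Finset.sum_comm] at h1
    have h2 := Finset.sum_le_sum (s := G) fun g _ => bessel φ hpos N b hbs hb1 hb0 g
    simp at h1
    linarith
  obtain ⟨i, hi⟩ := this
  obtain ⟨w, hw⟩ := hx1 i
  refine ⟨b i, ((s i * s i : ℝ) : ℂ) • (w * e * x i), ?_, ⟨_, rfl⟩, hb1 i, hi⟩
  rw [hb, mul_smul_comm]
  congr 1
  conv_lhs => enter [1]; rw [hw]
  simp only [mul_assoc]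

lemma exists_neg (hpos : ∀ a : B, 0 ≤ φ (star a * a)) (hu : φ 1 = 1)
    (hf : ∀ a : B, φ (star a * a) = 0 → a = 0) (hB : NoMin B)
    (a : B) (ha : IsSelfAdjoint a) (hn : (φ a).re < 0) :
    ∃ δ : ℝ, 0 < δ ∧ ∀ (G : Finset B) (ε : ℝ), 0 < ε → ∃ b : B, (∃ c : B, b = star c * c) ∧
      φ (b * b) = 1 ∧ (∀ g ∈ G, ‖φ (g * b)‖ < ε) ∧ (φ (b * a * b)).re ≤ -δ := by
  obtain ⟨δ, hδ⟩ : ∃ δ, δ = -(φ a).re / 2 := ⟨_, rfl⟩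
  have hδ0 : 0 < δ := by linarith
  have pos' : ∀ a : B, 0 ≤ (φ (star a * a)).re := fun a => (Complex.nonneg_iff.1 (hpos a)).1
  let f : ℝ → ℝ := fun x => min (x + δ) 0
  have cf : Continuous f := by fun_prop
  have hes : IsSelfAdjoint (cfc f a) := cfc_predicate _ _
  have lin : cfc (fun x : ℝ => x + δ) a = a + ((δ : ℝ) : ℂ) • 1 := by
    rw [cfc_add_const δ (fun x : ℝ => x) a, cfc_id' ℝ a, Algebra.algebraMap_eq_smul_one,
      Complex.coe_smul]
  have he0 : cfc f a ≠ 0 := by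
    intro h
    rw [← cfc_zero ℝ a, cfc_eq_cfc_iff_eqOn] at h
    have h1 : a + ((δ : ℝ) : ℂ) • 1 = star (cfc (fun x : ℝ => Real.sqrt (x + δ)) a) *
        cfc (fun x : ℝ => Real.sqrt (x + δ)) a := by
      rw [(cfc_predicate _ a : IsSelfAdjoint (cfc (fun x : ℝ => Real.sqrt (x + δ)) a)).star_eq,
        ← cfc_mul _ _ a, ← lin]
      apply cfc_congr
      intro x hx
      have := h hx
      simp only [f, Pi.zero_apply, min_eq_right_iff] at this
      exact (Real.mul_self_sqrt this).symm
    have h2 := pos' (cfc (fun x : ℝ => Real.sqrt (x + δ)) a)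
    rw [← h1, map_add, map_smul, hu] at h2
    simp at h2
    linarith
  refine ⟨δ, hδ0, fun G ε hε => ?_⟩
  obtain ⟨b, v, hbv, hbc, hb1, hbG⟩ := exists_orth φ hpos hf hB _ hes he0 G ε hε
  refine ⟨b, hbc, hb1, hbG, ?_⟩
  have hbs : star b = b := by obtain ⟨c, rfl⟩ := hbc; simp
  let q : ℝ → ℝ := fun x => Real.sqrt (-(f x * (x + δ) * f x))
  have cq : Continuous q := by fun_prop
  have h1 : cfc f a * (a + ((δ : ℝ) : ℂ) • 1) * cfc f a = - (star (cfc q a) * cfc q a) := by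
    rw [(cfc_predicate _ a : IsSelfAdjoint (cfc q a)).star_eq, ← lin,
      ← cfc_mul f (fun x => x + δ) a, ← cfc_mul (fun x => f x * (x + δ)) f a, ← cfc_mul q q a,
      ← cfc_neg]
    apply cfc_congr
    intro x hx
    simp only [q]
    rw [Real.mul_self_sqrt, neg_neg]
    have : f x * (x + δ) * f x = (x + δ) * (f x) ^ 2 := by ring
    rw [this]
    rcases le_total (x + δ) 0 with h | h
    · have := sq_nonneg (f x); nlinarith
    · have : f x = 0 := min_eq_right h
      simp [this]
  have h2 : b * a * b + ((δ : ℝ) : ℂ) • (b * b) = -(star (cfc q a * v) * (cfc q a * v)) := by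
    have h3 : b * a * b + ((δ : ℝ) : ℂ) • (b * b) = star b * (a + ((δ : ℝ) : ℂ) • 1) * b := by
      rw [hbs, mul_add, add_mul, mul_smul_comm, mul_one, smul_mul_assoc]
    rw [h3, hbv, star_mul, hes.star_eq]
    calc _ = star v * (cfc f a * (a + ((δ : ℝ) : ℂ) • 1) * cfc f a) * v := by
          simp only [mul_assoc]
      _ = _ := by rw [h1, star_mul]; simp only [mul_assoc, mul_neg, neg_mul]
  have h4 := congrArg (fun x => (φ x).re) h2
  simp only [map_add, map_smul, hb1, map_neg, Complex.add_re, Complex.neg_re, smul_eq_mul,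
    mul_one, Complex.ofReal_re] at h4
  have := pos' (cfc q a * v)
  linarith

lemma bdd (hpos : ∀ a : B, 0 ≤ φ (star a * a)) (a : B) (ha : IsSelfAdjoint a) (b : B)
    (hb : star b = b) (hb1 : φ (b * b) = 1) : (φ (b * a * b)).re ≤ ‖a‖ := by
  haveI : Nontrivial B := ⟨b * b, 0, fun h => by rw [h, map_zero] at hb1; exact zero_ne_one hb1⟩
  have h1 : ((‖a‖ : ℝ) : ℂ) • 1 - a = star (cfc (fun x : ℝ => Real.sqrt (‖a‖ - x)) a) *
        cfc (fun x : ℝ => Real.sqrt (‖a‖ - x)) a := by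
    rw [(cfc_predicate _ a : IsSelfAdjoint (cfc (fun x : ℝ => Real.sqrt (‖a‖ - x)) a)).star_eq,
        ← cfc_mul _ _ a]
    have lin : cfc (fun x : ℝ => ‖a‖ - x) a = ((‖a‖ : ℝ) : ℂ) • 1 - a := by
      rw [cfc_sub (fun _ => ‖a‖) (fun x : ℝ => x) a, cfc_id' ℝ a, cfc_const ‖a‖ a,
        Algebra.algebraMap_eq_smul_one, Complex.coe_smul]
    rw [← lin]
    apply cfc_congr
    intro x hx
    have := (le_abs_self x).trans (spectrum.norm_le_norm_of_mem hx)
    exact (Real.mul_self_sqrt (sub_nonneg.2 this)).symm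
  have h2 := (Complex.nonneg_iff.1 (hpos (cfc (fun x : ℝ => Real.sqrt (‖a‖ - x)) a * b))).1
  have h3 : star (cfc (fun x : ℝ => Real.sqrt (‖a‖ - x)) a * b) *
      (cfc (fun x : ℝ => Real.sqrt (‖a‖ - x)) a * b) = ((‖a‖ : ℝ) : ℂ) • (b * b) - b * a * b := by
    calc _ = star b * (star (cfc (fun x : ℝ => Real.sqrt (‖a‖ - x)) a) *
        cfc (fun x : ℝ => Real.sqrt (‖a‖ - x)) a) * b := by rw [star_mul]; simp only [mul_assoc]
      _ = _ := by rw [← h1, hb, mul_sub, sub_mul, mul_smul_comm, mul_one, smul_mul_assoc]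
  rw [h3, map_sub, map_smul, hb1] at h2
  simp at h2
  linarith

/-- approximable vectors -/
def CC {n : Type} (a : n → B) : Set (n → ℝ) :=
  {v | ∀ (G : Finset B) (ε : ℝ), 0 < ε → ∃ b : B, (∃ c : B, b = star c * c) ∧
    (∀ g ∈ G, ‖φ (g * b)‖ < ε) ∧ ∀ i, |(φ (b * a i * b)).re - v i| < ε}

lemma CC_zero {n : Type} (a : n → B) : 0 ∈ CC φ a := by
  intro G ε hε
  exact ⟨0, ⟨0, by simp⟩, by simpa using fun _ _ => hε, by simpa using fun _ => hε⟩

lemma pos_add (x y : B) : ∃ c : B, star x * x + star y * y = star c * c := by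
  letI := CStarAlgebra.spectralOrder B
  haveI := CStarAlgebra.spectralOrderedRing B
  exact CStarAlgebra.nonneg_iff_eq_star_mul_self.1
    (add_nonneg (star_mul_self_nonneg x) (star_mul_self_nonneg y))

lemma CC_smul {n : Type} (a : n → B) (v : n → ℝ) (hv : v ∈ CC φ a) (t : ℝ) (ht : 0 < t) :
    t • v ∈ CC φ a := by
  intro G ε hε
  have hs : 0 < Real.sqrt t := Real.sqrt_pos.2 ht
  obtain ⟨b, ⟨c, hc⟩, hG, hb⟩ := hv G (min (ε / Real.sqrt t) (ε / t)) (by positivity)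
  refine ⟨((Real.sqrt t : ℝ) : ℂ) • b, ⟨((Real.sqrt (Real.sqrt t) : ℝ) : ℂ) • c, ?_⟩, ?_, ?_⟩
  · rw [star_smul, smul_mul_smul_comm, ← hc]
    congr 1
    simp only [Complex.star_def, Complex.conj_ofReal]
    rw [← Complex.ofReal_mul, Real.mul_self_sqrt hs.le]
  · intro g hg
    rw [mul_smul_comm, map_smul, norm_smul, Complex.norm_real, Real.norm_of_nonneg hs.le]
    have := (hG g hg).trans_le (min_le_left _ _)
    rwa [lt_div_iff₀ hs, mul_comm] at this
  · intro i
    have e : φ ((((Real.sqrt t : ℝ) : ℂ) • b) * a i * (((Real.sqrt t : ℝ) : ℂ) • b)) =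
        (t : ℂ) * φ (b * a i * b) := by
      rw [smul_mul_assoc, smul_mul_smul_comm, map_smul, ← Complex.ofReal_mul,
        Real.mul_self_sqrt ht.le, smul_eq_mul]
    rw [e, Complex.re_ofReal_mul, Pi.smul_apply, smul_eq_mul, ← mul_sub, abs_mul, abs_of_pos ht]
    have := (hb i).trans_le (min_le_right _ _)
    rwa [lt_div_iff₀ ht, mul_comm] at this

lemma CC_add (hpos : ∀ a : B, 0 ≤ φ (star a * a)) {n : Type} [Fintype n] (a : n → B)
    (ha : ∀ i, star (a i) = a i) (v w : n → ℝ) (hv : v ∈ CC φ a)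
    (hw : w ∈ CC φ a) : v + w ∈ CC φ a := by
  classical
  intro G ε hε
  obtain ⟨b, ⟨c, hc⟩, hbG, hb⟩ := hv G (ε / 4) (by positivity)
  obtain ⟨d, ⟨c', hc'⟩, hdG, hd⟩ := hw (G ∪ Finset.univ.image fun i => b * a i) (ε / 4)
    (by positivity)
  have hbs : star b = b := by rw [hc]; simp
  have hds : star d = d := by rw [hc']; simp
  refine ⟨b + d, ?_, ?_, ?_⟩
  · rw [hc, hc']; exact pos_add c c'
  · intro g hg
    rw [mul_add, map_add]
    have h1 := hbG g hg
    have h2 := hdG g (Finset.mem_union_left _ hg)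
    have h3 := norm_add_le (φ (g * b)) (φ (g * d))
    linarith
  · intro i
    have h1 : ‖φ (b * a i * d)‖ < ε / 4 := hdG _ (Finset.mem_union_right _ (by simp))
    have h2 : φ (d * a i * b) = star (φ (b * a i * d)) := by
      rw [← phi_star φ hpos]; simp only [star_mul, hbs, hds, ha, mul_assoc]
    have h3 : φ ((b + d) * a i * (b + d)) = φ (b * a i * b) + φ (d * a i * d) +
        φ (b * a i * d) + star (φ (b * a i * d)) := by
      rw [← h2]; simp only [add_mul, mul_add, map_add]; ring
    have h4 := (Complex.abs_re_le_norm _).trans_lt h1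
    have h5 := hb i
    have h6 := hd i
    rw [h3]
    simp only [Complex.add_re, Complex.star_def, Complex.conj_re, Pi.add_apply]
    rw [abs_lt] at *
    constructor <;> linarith

lemma CC_closed {n : Type} [Fintype n] (a : n → B) : IsClosed (CC φ a) := by
  rw [← closure_subset_iff_isClosed]
  intro v hv G ε hε
  obtain ⟨w, hw, hd⟩ := Metric.mem_closure_iff.1 hv (ε / 2) (by positivity)
  obtain ⟨b, hb, hbG, hbi⟩ := hw G (ε / 2) (by positivity)
  refine ⟨b, hb, fun g hg => (hbG g hg).trans (by linarith), fun i => ?_⟩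
  have h1 := hbi i
  have h2 := (dist_le_pi_dist v w i).trans_lt hd
  rw [Real.dist_eq] at h2
  rw [abs_lt] at *
  constructor <;> linarith

lemma main_sa (hpos : ∀ a : B, 0 ≤ φ (star a * a)) (hu : φ 1 = 1)
    (hf : ∀ a : B, φ (star a * a) = 0 → a = 0) (hB : NoMin B)
    {n : Type} [Fintype n] (a : n → B) (ha : ∀ i, star (a i) = a i) :
    (fun i => (φ (a i)).re) ∈ CC φ a := by
  classical
  by_contra hc
  have hconv : Convex ℝ (CC φ a) := by
    rw [convex_iff_forall_pos]
    intro x hx y hy s t hs ht _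
    exact CC_add φ hpos a ha _ _ (CC_smul φ a x hx s hs) (CC_smul φ a y hy t ht)
  obtain ⟨f, u, h1, h2⟩ := geometric_hahn_banach_point_closed hconv (CC_closed φ a) hc
  have hu0 : u < 0 := by simpa using h2 0 (CC_zero φ a)
  have hcone : ∀ v ∈ CC φ a, 0 ≤ f v := by
    intro v hv
    by_contra hneg
    push Not at hneg
    have := h2 _ (CC_smul φ a v hv (u / f v) (div_pos_of_neg_of_neg hu0 hneg))
    rw [map_smul, smul_eq_mul, div_mul_cancel₀ _ hneg.ne] at this
    exact lt_irrefl _ this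
  have hfv : ∀ v : n → ℝ, f v = ∑ i, v i * f (Pi.single i 1) := by
    intro v
    conv_lhs => rw [pi_eq_sum_univ' v]
    simp only [map_sum, map_smul, smul_eq_mul]
  obtain ⟨a0, ha0⟩ : ∃ a0 : B, a0 = ∑ i, ((f (Pi.single i 1) : ℝ) : ℂ) • a i := ⟨_, rfl⟩
  have hφa : ∀ b : B, (φ (b * a0 * b)).re = f (fun i => (φ (b * a i * b)).re) := by
    intro b
    rw [hfv, ha0]
    simp only [Finset.mul_sum, Finset.sum_mul, mul_smul_comm, smul_mul_assoc, map_sum, map_smul,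
      Complex.re_sum, smul_eq_mul, Complex.re_ofReal_mul]
    exact Finset.sum_congr rfl fun i _ => mul_comm _ _
  have ha0s : IsSelfAdjoint a0 := by
    rw [IsSelfAdjoint, ha0, star_sum]
    simp [ha]
  have hneg : (φ a0).re < 0 := by
    have := hφa 1
    simp only [one_mul, mul_one] at this
    rw [this]; exact h1.trans hu0
  obtain ⟨δ, hδ, H⟩ := exists_neg φ hpos hu hf hB a0 ha0s hneg
  choose b hb1 hb2 hb3 hb4 using fun p : Finset B × ℕ =>
    H p.1 (1 / ((p.2 : ℝ) + 1)) (by positivity)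
  have hbs : ∀ p, star (b p) = b p := by
    intro p; obtain ⟨c, hc⟩ := hb1 p; rw [hc]; simp
  let W : Finset B × ℕ → (n → ℝ) := fun p i => (φ (b p * a i * b p)).re
  have hK : IsCompact (Set.Icc (fun i => -‖a i‖) (fun i => ‖a i‖) ∩ {v | f v ≤ -δ}) :=
    isCompact_Icc.inter_right (isClosed_le f.continuous continuous_const)
  have hWK : ∀ p, W p ∈ (Set.Icc (fun i => -‖a i‖) (fun i => ‖a i‖) ∩ {v | f v ≤ -δ}) := by
    intro p
    refine ⟨⟨fun i => ?_, fun i => bdd φ hpos (a i) (ha i) _ (hbs p) (hb2 p)⟩, ?_⟩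
    · have := bdd φ hpos (-a i) (by rw [IsSelfAdjoint, star_neg, ha]) _ (hbs p) (hb2 p)
      simp only [mul_neg, neg_mul, map_neg, Complex.neg_re, norm_neg] at this
      simp only [W]
      linarith
    · have := hb4 p
      rwa [hφa] at this
  obtain ⟨v, hv, hcl⟩ := hK.exists_mapClusterPt (f := Filter.atTop) (u := W)
    (Filter.le_principal_iff.2 (Filter.mem_map.2 (Filter.univ_mem' hWK)))
  have hvC : v ∈ CC φ a := by
    intro G ε hε
    obtain ⟨m, hm⟩ := exists_nat_one_div_lt hε
    have hfr := hcl.frequently (Metric.ball_mem_nhds v hε)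
    obtain ⟨p, hp, hpge⟩ := (hfr.and_eventually (Filter.eventually_ge_atTop (G, m))).exists
    refine ⟨b p, hb1 p, fun g hg => ?_, fun i => ?_⟩
    · refine (hb3 p g (hpge.1 hg)).trans (lt_of_le_of_lt ?_ hm)
      have : (m : ℝ) ≤ p.2 := by exact_mod_cast hpge.2
      gcongr
    · have := (dist_le_pi_dist (W p) v i).trans_lt hp
      rwa [Real.dist_eq] at this
  have h3 := hcone v hvC
  have h4 : f v ≤ -δ := hv.2
  linarith

lemma main_aux (hpos : ∀ a : B, 0 ≤ φ (star a * a)) (hu : φ 1 = 1)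
    (hf : ∀ a : B, φ (star a * a) = 0 → a = 0) (hB : NoMin B)
    (F : Finset B) (ε : ℝ) (hε : 0 < ε) :
    ∃ b : B, (∃ c : B, b = star c * c) ∧
      ∀ a ∈ F, ‖φ (a * b)‖ < ε ∧ ‖φ (b * a * b) - φ a‖ < ε := by
  let A : F ⊕ F → B := Sum.elim (fun x => realPart (x : B)) (fun x => imaginaryPart (x : B))
  have hA : ∀ i, star (A i) = A i := by
    rintro (i | i)
    · exact (realPart (i : B)).2
    · exact (imaginaryPart (i : B)).2
  obtain ⟨b, ⟨c, hc⟩, hG, hb⟩ := main_sa φ hpos hu hf hB A hA F (ε / 2) (by positivity)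
  have hbs : star b = b := by rw [hc]; simp
  have im0 : ∀ x : B, star x = x → (φ x).im = 0 := by
    intro x hx
    have := congrArg Complex.im (phi_star φ hpos x)
    rw [hx] at this
    simp at this
    linarith
  have hN : ∀ i, ‖φ (b * A i * b) - φ (A i)‖ < ε / 2 := by
    intro i
    have h1 : φ (b * A i * b) - φ (A i) =
        (((φ (b * A i * b)).re - (φ (A i)).re : ℝ) : ℂ) := by
      apply Complex.ext
      · simp
      · simp [im0 _ (hA i), im0 (b * A i * b) (by simp [hbs, hA, mul_assoc])]
    rw [h1, Complex.norm_real]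
    exact hb i
  refine ⟨b, ⟨c, hc⟩, fun a ha => ⟨(hG a ha).trans (by linarith), ?_⟩⟩
  have h1 := hN (Sum.inl ⟨a, ha⟩)
  have h2 := hN (Sum.inr ⟨a, ha⟩)
  simp only [A, Sum.elim_inl, Sum.elim_inr] at h1 h2
  have e : φ (b * a * b) - φ a = (φ (b * realPart a * b) - φ (realPart a)) +
      Complex.I * (φ (b * imaginaryPart a * b) - φ (imaginaryPart a)) := by
    conv_lhs => rw [← realPart_add_I_smul_imaginaryPart a]
    simp only [mul_add, add_mul, map_add, mul_smul_comm, smul_mul_assoc, map_smul, smul_eq_mul]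
    ring
  rw [e]
  refine (norm_add_le _ _).trans_lt ?_
  rw [norm_mul, Complex.norm_I, one_mul]
  linarith
end

end Aux

/-- (Ozawa) Let `φ` be a faithful state on a unital C*-algebra `B` containing no non-zero
projection `p` with `p B p = ℂ p`. Then for every finite `F ⊆ B` and `ε > 0` there is a
positive `b ∈ B` with `|φ(a b)| < ε` and `|φ(b a b) - φ(a)| < ε` for all `a ∈ F`. -/
theorem faithful_state_approximation {B : Type} [NormedRing B] [StarRing B] [CStarRing B]
    [NormedAlgebra ℂ B] [CompleteSpace B] [StarModule ℂ B]
    (φ : B →ₗ[ℂ] ℂ) (hφ_unital : φ 1 = 1) (hφ_pos : ∀ a : B, 0 ≤ φ (star a * a))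
    (hφ_faithful : ∀ a : B, φ (star a * a) = 0 → a = 0)
    (hB_noproj : ¬ ∃ p : B, p ≠ 0 ∧ star p = p ∧ p * p = p ∧
      ∀ x : B, ∃ c : ℂ, p * x * p = c • p)
    (F : Finset B) (ε : ℝ) (hε : 0 < ε) :
    ∃ b : B, (∃ c : B, b = star c * c) ∧
      ∀ a ∈ F, ‖φ (a * b)‖ < ε ∧ ‖φ (b * a * b) - φ a‖ < ε := by
  letI : CStarAlgebra B := { }
  exact main_aux φ hφ_pos hφ_unital hφ_faithful hB_noproj F ε hε
end
end

section
/- Let B be a unital C*-algebra, φ a state on B, and B₀ a unital C*-subalgebra of B contained in the centralizer {x ∈ B : φ(x b) = φ(b x) for all b ∈ B} of φ. Suppose there exists a φ-preserving conditional expectation E from B onto B₀, i.e. a positive linear map E : B → B whose range is contained in B₀ satisfying E(b) = b for all b ∈ B₀, E(b x c) = b E(x) c for all b, c ∈ B₀ and x ∈ B, and φ ∘ E = φ. If the restriction of φ to B₀ is a GNS-essential state on B₀, then for every finite subset F of B and every ε > 0 there exists b ∈ B₀ with φ(b* b) = 1, φ(b b*) = 1, |φ(x b)| < ε and |φ(b*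 x b) − φ(x)| < ε for all x ∈ F. (Equivalently, there is a net (b_i) in B such that lim_i φ(b_i b_i*) = 1, lim_i φ(b_i* x b_i) = φ(x) and lim_i φ(x b_i) = 0 for every x ∈ B.) -/
open scoped InnerProductSpace ComplexOrder

noncomputable section

lemma aux_dec {A : Type} [CStarAlgebra A] (k : A) (hk : IsSelfAdjoint k) :
    ∃ p q : A, IsSelfAdjoint p ∧ IsSelfAdjoint q ∧ k = p * p - q * q ∧
      k * (p * p) = (p * p) * (p * p) := by
  have c1 : Continuous (fun x : ℝ => Real.sqrt (max x 0)) := by fun_prop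
  have c2 : Continuous (fun x : ℝ => Real.sqrt (max (-x) 0)) := by fun_prop
  have hp : cfc (fun x : ℝ => Real.sqrt (max x 0)) k * cfc (fun x : ℝ => Real.sqrt (max x 0)) k
      = cfc (fun x : ℝ => max x 0) k := by
    rw [← cfc_mul _ _ k c1.continuousOn c1.continuousOn]
    congr 1; ext x; exact Real.mul_self_sqrt (le_max_right _ _)
  have hq : cfc (fun x : ℝ => Real.sqrt (max (-x) 0)) k * cfc (fun x : ℝ => Real.sqrt (max (-x) 0)) k
      = cfc (fun x : ℝ => max (-x) 0) k := by
    rw [← cfc_mul _ _ k c2.continuousOn c2.continuousOn]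
    congr 1; ext x; exact Real.mul_self_sqrt (le_max_right _ _)
  have d1 : Continuous (fun x : ℝ => max x 0) := by fun_prop
  have d2 : Continuous (fun x : ℝ => max (-x) 0) := by fun_prop
  refine ⟨_, _, cfc_predicate (fun x : ℝ => Real.sqrt (max x 0)) k,
    cfc_predicate (fun x : ℝ => Real.sqrt (max (-x) 0)) k, ?_, ?_⟩
  · rw [hp, hq, ← cfc_sub _ _ k d1.continuousOn d2.continuousOn]
    conv_lhs => rw [← cfc_id' ℝ k]
    congr 1; ext x
    rcases le_total x 0 with h | h
    · rw [max_eq_right h, max_eq_left (by linarith)]; ring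
    · rw [max_eq_left h, max_eq_right (by linarith)]; ring
  · rw [hp, ← cfc_mul _ _ k d1.continuousOn d1.continuousOn]
    conv_lhs => rw [← cfc_id' ℝ k]
    rw [cfc_id' ℝ k]
    nth_rewrite 1 [← cfc_id' ℝ k]
    rw [← cfc_mul (fun x : ℝ => x) _ k continuousOn_id d1.continuousOn]
    congr 1; ext x
    rcases le_total x 0 with h | h
    · rw [max_eq_right h]; simp
    · rw [max_eq_left h]

section
variable {A H : Type} [Ring A] [StarRing A] [Algebra ℂ A]
  [NormedAddCommGroup H] [InnerProductSpace ℂ H] [CompleteSpace H]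

lemma aux_sa_s7 (π : A →⋆ₐ[ℂ] (H →L[ℂ] H)) (a : A) (ha : IsSelfAdjoint a) (x y : H) :
    ⟪x, π a y⟫_ℂ = ⟪π a x, y⟫_ℂ := by
  have : ContinuousLinearMap.adjoint (π a) = π a := by
    rw [← ContinuousLinearMap.star_eq_adjoint, ← map_star, ha.star_eq]
  rw [← ContinuousLinearMap.adjoint_inner_left, this]

/-- If `k` is strictly negative on the orthocomplement of a finite-dim. space, then `τ(k) ≤ 0`. -/
lemma aux_neg (π : A →⋆ₐ[ℂ] (H →L[ℂ] H))
    (hess : ∀ x : A, IsCompactOperator ⇑(π x) → π x = 0)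
    (p q k : A) (hp : IsSelfAdjoint p) (hq : IsSelfAdjoint q) (hk : k = p * p - q * q)
    (hkp : k * (p * p) = (p * p) * (p * p)) (ξ : H)
    (V : Submodule ℂ H) [FiniteDimensional ℂ V]
    (hV : ∀ η ∈ Vᗮ, η ≠ 0 → (⟪η, π k η⟫_ℂ).re < 0) : (⟪ξ, π k ξ⟫_ℂ).re ≤ 0 := by
  have h0 : π (p * p) = 0 := by
    apply hess
    set f : H →L[ℂ] H := π (p * p) with hf
    have key : ∀ ζ, f ζ ∈ Vᗮ → f ζ = 0 := by
      intro ζ hζ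
      by_contra hne
      have h1 := hV _ hζ hne
      have h2 : π k (f ζ) = π p (π p (f ζ)) := by
        have := congrArg (fun a => π a ζ) hkp
        simp only [map_mul, mul_apply_eq_comp] at this
        simpa [hf] using this
      rw [h2, aux_sa_s7 π p hp] at h1
      have : 0 ≤ (⟪π p (f ζ), π p (f ζ)⟫_ℂ).re := inner_self_nonneg (𝕜 := ℂ)
      linarith
    have hfin : FiniteDimensional ℂ (LinearMap.range (f : H →ₗ[ℂ] H)) := by
      let g : LinearMap.range (f : H →ₗ[ℂ] H) →ₗ[ℂ] V :=
        (V.orthogonalProjectionOnto : H →ₗ[ℂ] V).comp (Submodule.subtype _)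
      apply FiniteDimensional.of_injective g
      rw [← LinearMap.ker_eq_bot, LinearMap.ker_eq_bot']
      rintro ⟨_, ζ, rfl⟩ h
      have h' : V.orthogonalProjectionOnto (f ζ) = 0 := h
      rw [Submodule.orthogonalProjectionOnto_eq_zero_iff] at h'
      exact Subtype.ext (key ζ h')
    have hc : IsCompactOperator ((Submodule.subtypeL (LinearMap.range (f : H →ₗ[ℂ] H))) ∘
        (f.codRestrict (LinearMap.range (f : H →ₗ[ℂ] H)) (fun x => ⟨x, rfl⟩))) := by
      have : ProperSpace (LinearMap.range (f : H →ₗ[ℂ] H)) := FiniteDimensional.proper ℂ _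
      have hid : IsCompactOperator (fun x : LinearMap.range (f : H →ₗ[ℂ] H) => x) :=
        ⟨Metric.closedBall 0 1, isCompact_closedBall _ _, Metric.closedBall_mem_nhds _ one_pos⟩
      exact (hid.comp_clm (f.codRestrict (LinearMap.range (f : H →ₗ[ℂ] H)) (fun x => ⟨x, rfl⟩))).clm_comp
        (Submodule.subtypeL (LinearMap.range (f : H →ₗ[ℂ] H)))
    exact hc
  rw [hk, map_sub, h0]
  simp only [zero_sub, map_mul, neg_apply, mul_apply_eq_comp, inner_neg_right]
  rw [aux_sa_s7 π q hq]
  have : 0 ≤ (⟪π q ξ, π q ξ⟫_ℂ).re := inner_self_nonneg (𝕜 := ℂ)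
  rw [Complex.neg_re]
  linarith

def auxW {ι : Type} (π : A →⋆ₐ[ℂ] (H →L[ℂ] H)) (h : ι → A) (η : H) : ι → ℝ :=
  fun i => (⟪η, π (h i) η⟫_ℂ).re

def auxS {ι : Type} (π : A →⋆ₐ[ℂ] (H →L[ℂ] H)) (h : ι → A) (V : Submodule ℂ H) : Set (ι → ℝ) :=
  closure (auxW π h '' {η | η ∈ Vᗮ ∧ ‖η‖ = 1})

lemma auxS_anti {ι : Type} (π : A →⋆ₐ[ℂ] (H →L[ℂ] H)) (h : ι → A) {V V' : Submodule ℂ H}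
    (hV : V ≤ V') : auxS π h V' ⊆ auxS π h V :=
  closure_mono (Set.image_mono fun _ hη => ⟨Submodule.orthogonal_le hV hη.1, hη.2⟩)

lemma auxS_compact {ι : Type} [Fintype ι] (π : A →⋆ₐ[ℂ] (H →L[ℂ] H)) (h : ι → A)
    (V : Submodule ℂ H) : IsCompact (auxS π h V) := by
  have hK : IsCompact (Set.pi Set.univ fun i => Set.Icc (-‖π (h i)‖) ‖π (h i)‖) :=
    isCompact_univ_pi fun i => isCompact_Icc
  refine hK.closure_of_subset ?_
  rintro _ ⟨η, ⟨-, hη⟩, rfl⟩ i -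
  rw [Set.mem_Icc, ← abs_le]
  calc |(⟪η, π (h i) η⟫_ℂ).re| ≤ ‖⟪η, π (h i) η⟫_ℂ‖ := Complex.abs_re_le_norm _
    _ ≤ ‖η‖ * ‖π (h i) η‖ := norm_inner_le_norm _ _
    _ ≤ ‖η‖ * (‖π (h i)‖ * ‖η‖) := by gcongr; exact (π (h i)).le_opNorm η
    _ = ‖π (h i)‖ := by rw [hη]; ring

lemma aux_convex {ι : Type} [Fintype ι] (π : A →⋆ₐ[ℂ] (H →L[ℂ] H)) (h : ι → A)
    (hh : ∀ i, IsSelfAdjoint (h i)) :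
    Convex ℝ (⋂ V : {V : Submodule ℂ H // FiniteDimensional ℂ V}, auxS π h V.1) := by
  intro x hx y hy a b ha hb hab
  rw [Set.mem_iInter] at hx hy ⊢
  rintro ⟨V, hV⟩
  refine Metric.mem_closure_iff.2 fun ε hε => ?_
  obtain ⟨_, ⟨η₁, ⟨h1V, h1⟩, rfl⟩, hd1⟩ := Metric.mem_closure_iff.1 (hx ⟨V, hV⟩) ε hε
  have hfin : FiniteDimensional ℂ
      ↥(V ⊔ (Submodule.span ℂ {η₁} ⊔ Submodule.span ℂ (Set.range fun i => π (h i) η₁))) := by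
    have := FiniteDimensional.span_of_finite ℂ (Set.finite_range fun i => π (h i) η₁)
    infer_instance
  obtain ⟨_, ⟨η₂, ⟨h2V, h2⟩, rfl⟩, hd2⟩ := Metric.mem_closure_iff.1 (hy ⟨_, hfin⟩) ε hε
  have o1 : ⟪η₁, η₂⟫_ℂ = 0 := h2V η₁ (Submodule.mem_sup_right (Submodule.mem_sup_left
    (Submodule.mem_span_singleton_self _)))
  have o2 : ∀ i, ⟪π (h i) η₁, η₂⟫_ℂ = 0 := fun i => h2V _ (Submodule.mem_sup_right
    (Submodule.mem_sup_right (Submodule.subset_span ⟨i, rfl⟩)))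
  have o3 : ⟪η₂, η₁⟫_ℂ = 0 := inner_eq_zero_symm.1 o1
  have o4 : ∀ i, ⟪η₂, π (h i) η₁⟫_ℂ = 0 := fun i => inner_eq_zero_symm.1 (o2 i)
  have o5 : ∀ i, ⟪η₁, π (h i) η₂⟫_ℂ = 0 := fun i => by rw [aux_sa_s7 π _ (hh i), o2 i]
  have sa : (Real.sqrt a : ℂ) * Real.sqrt a = a := by
    rw [← Complex.ofReal_mul, Real.mul_self_sqrt ha]
  have sb : (Real.sqrt b : ℂ) * Real.sqrt b = b := by
    rw [← Complex.ofReal_mul, Real.mul_self_sqrt hb]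
  set η : H := (Real.sqrt a : ℂ) • η₁ + (Real.sqrt b : ℂ) • η₂ with hη
  have hn : ‖η‖ = 1 := by
    have e : ⟪η, η⟫_ℂ = 1 := by
      have n1 : ⟪η₁, η₁⟫_ℂ = 1 := by rw [inner_self_eq_norm_sq_to_K, h1]; simp
      have n2 : ⟪η₂, η₂⟫_ℂ = 1 := by rw [inner_self_eq_norm_sq_to_K, h2]; simp
      have hab' : (a : ℂ) + b = 1 := by exact_mod_cast hab
      simp only [hη, inner_add_left, inner_add_right, inner_smul_left, inner_smul_right, o1, o3,
        Complex.conj_ofReal, n1, n2]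
      linear_combination sa + sb + hab'
    rw [inner_self_eq_norm_sq_to_K] at e
    have e' : ‖η‖ ^ 2 = 1 := Complex.ofReal_injective (by simpa using e)
    nlinarith [norm_nonneg η]
  have hw : auxW π h η = a • auxW π h η₁ + b • auxW π h η₂ := by
    ext i
    have e : ⟪η, π (h i) η⟫_ℂ = a * ⟪η₁, π (h i) η₁⟫_ℂ + b * ⟪η₂, π (h i) η₂⟫_ℂ := by
      simp only [hη, inner_add_left, inner_add_right, inner_smul_left, inner_smul_right, o4, o5,
        Complex.conj_ofReal, map_add, map_smul]
      linear_combination ⟪η₁, π (h i) η₁⟫_ℂ * sa + ⟪η₂, π (h i) η₂⟫_ℂ * sb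
    simp only [auxW, e, Pi.add_apply, Pi.smul_apply, smul_eq_mul, Complex.add_re,
      Complex.re_ofReal_mul]
  refine ⟨_, ⟨η, ⟨?_, hn⟩, rfl⟩, ?_⟩
  · exact Submodule.add_mem _ (Submodule.smul_mem _ _ h1V)
      (Submodule.smul_mem _ _ (Submodule.orthogonal_le le_sup_left h2V))
  · rw [hw, dist_eq_norm]
    have := (convex_ball (0 : ι → ℝ) ε) (x := x - auxW π h η₁) (by
      rwa [mem_ball_zero_iff, ← dist_eq_norm]) (y := y - auxW π h η₂) (by
      rwa [mem_ball_zero_iff, ← dist_eq_norm]) ha hb hab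
    rw [mem_ball_zero_iff] at this
    have e : a • x + b • y - (a • auxW π h η₁ + b • auxW π h η₂) =
        a • (x - auxW π h η₁) + b • (y - auxW π h η₂) := by
      rw [smul_sub, smul_sub]; abel
    rw [e]
    exact this

lemma aux_glimm {ι : Type} [Fintype ι] (π : A →⋆ₐ[ℂ] (H →L[ℂ] H)) [StarModule ℂ A]
    (hess : ∀ x : A, IsCompactOperator ⇑(π x) → π x = 0)
    (hdec : ∀ k : A, IsSelfAdjoint k → ∃ p q : A, IsSelfAdjoint p ∧ IsSelfAdjoint q ∧
      k = p * p - q * q ∧ k * (p * p) = (p * p) * (p * p))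
    (h : ι → A) (hh : ∀ i, IsSelfAdjoint (h i)) (ξ : H) (hξ : ‖ξ‖ = 1)
    (V : Submodule ℂ H) (hV : FiniteDimensional ℂ V) : auxW π h ξ ∈ auxS π h V := by
  classical
  suffices hs : auxW π h ξ ∈ ⋂ V : {V : Submodule ℂ H // FiniteDimensional ℂ V}, auxS π h V.1 from
    Set.mem_iInter.1 hs ⟨V, hV⟩
  by_contra hne
  obtain ⟨l, s, hl1, hl2⟩ := geometric_hahn_banach_closed_point (aux_convex π h hh)
    (isClosed_iInter fun _ => isClosed_closure) hne
  -- some `V` is separated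
  have hsep : ∃ V : {V : Submodule ℂ H // FiniteDimensional ℂ V},
      auxS π h V.1 ∩ {v | s ≤ l v} = ∅ := by
    by_contra! hcon
    have : Nonempty {V : Submodule ℂ H // FiniteDimensional ℂ V} := ⟨⟨V, hV⟩⟩
    have hcl : IsClosed {v | s ≤ l v} := isClosed_le continuous_const l.continuous
    obtain ⟨v, hv⟩ := IsCompact.nonempty_iInter_of_directed_nonempty_isCompact_isClosed
      (fun V : {V : Submodule ℂ H // FiniteDimensional ℂ V} => auxS π h V.1 ∩ {v | s ≤ l v})
      (by
        rintro ⟨V, hV⟩ ⟨V', hV'⟩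
        refine ⟨⟨V ⊔ V', inferInstance⟩, ?_, ?_⟩
        · exact Set.inter_subset_inter_left _ (auxS_anti π h le_sup_left)
        · exact Set.inter_subset_inter_left _ (auxS_anti π h le_sup_right))
      hcon (fun V => (auxS_compact π h V.1).inter_right hcl)
      (fun V => isClosed_closure.inter hcl)
    rw [Set.mem_iInter] at hv
    have h1 := hl1 v (Set.mem_iInter.2 fun V => (hv V).1)
    have h2 : s ≤ l v := (hv ⟨V, hV⟩).2
    linarith
  obtain ⟨⟨V, hV⟩, hVs⟩ := hsep
  have hneg : ∀ η ∈ Vᗮ, ‖η‖ = 1 → l (auxW π h η) < s := by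
    intro η hη hn
    by_contra! hc
    have : auxW π h η ∈ auxS π h V ∩ {v | s ≤ l v} := ⟨subset_closure ⟨η, ⟨hη, hn⟩, rfl⟩, hc⟩
    rw [hVs] at this
    exact this
  set c : ι → ℝ := fun i => l (Pi.single i 1) with hc
  have hlc : ∀ v, l v = ∑ i, c i * v i := by
    intro v
    conv_lhs => rw [pi_eq_sum_univ' v]
    simp only [map_sum, map_smul, smul_eq_mul, hc]
    refine Finset.sum_congr rfl fun i _ => ?_
    rw [mul_comm]
  set k : A := ∑ i, (c i : ℂ) • h i - (s : ℂ) • 1 with hk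
  have hksa : IsSelfAdjoint k := by
    have : ∀ (r : ℝ) (a : A), IsSelfAdjoint a → IsSelfAdjoint ((r : ℂ) • a) := by
      intro r a ha
      rw [IsSelfAdjoint, star_smul, ha.star_eq]
      simp
    exact (isSelfAdjoint_sum _ fun i _ => this _ _ (hh i)).sub (this _ _ (IsSelfAdjoint.one A))
  have hkin : ∀ η : H, (⟪η, π k η⟫_ℂ).re = l (auxW π h η) - s * ‖η‖ ^ 2 := by
    intro η
    have : π k η = ∑ i, (c i : ℂ) • π (h i) η - (s : ℂ) • η := by
      rw [hk, map_sub, map_sum, map_smul, map_one]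
      simp only [map_smul]
      simp only [sub_apply, ContinuousLinearMap.sum_apply, smul_apply, one_apply_eq_self]
    rw [this, hlc, inner_sub_right, inner_sum, inner_smul_right, inner_self_eq_norm_sq_to_K]
    simp only [inner_smul_right, Complex.sub_re, Complex.re_sum, Complex.re_ofReal_mul, auxW]
    norm_cast
  obtain ⟨p, q, hp, hq, h1, h2⟩ := hdec k hksa
  have := aux_neg π hess p q k hp hq h1 h2 ξ V (by
    intro η hη hη0
    have hn : 0 < ‖η‖ := norm_pos_iff.2 hη0
    have h3 := hneg ((‖η‖⁻¹ : ℂ) • η) (Submodule.smul_mem _ _ hη) (by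
      rw [norm_smul]; simp [hn.ne'])
    have h4 : auxW π h ((‖η‖⁻¹ : ℂ) • η) = (‖η‖⁻¹ * ‖η‖⁻¹) • auxW π h η := by
      ext i
      simp only [auxW, map_smul, inner_smul_left, inner_smul_right, Pi.smul_apply, smul_eq_mul,
        ← Complex.ofReal_inv, Complex.conj_ofReal, ← mul_assoc, ← Complex.ofReal_mul,
        Complex.re_ofReal_mul]
    rw [h4, map_smul, smul_eq_mul] at h3
    rw [hkin]
    have h5 : l (auxW π h η) = (‖η‖⁻¹ * ‖η‖⁻¹ * l (auxW π h η)) * ‖η‖ ^ 2 := by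
      field_simp
    have : (‖η‖⁻¹ * ‖η‖⁻¹ * l (auxW π h η)) * ‖η‖ ^ 2 < s * ‖η‖ ^ 2 := by gcongr
    linarith)
  rw [hkin, hξ] at this
  linarith
end

lemma aux_final {A H : Type} [CStarAlgebra A]
    [NormedAddCommGroup H] [InnerProductSpace ℂ H] [CompleteSpace H]
    (π : A →⋆ₐ[ℂ] (H →L[ℂ] H))
    (hess : ∀ x : A, IsCompactOperator ⇑(π x) → π x = 0)
    (ξ : H) (hξ : ‖ξ‖ = 1) (hcyc : DenseRange fun b : A => π b ξ)
    (F : Finset A) (ε : ℝ) (hε : 0 < ε) :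
    ∃ b : A, ‖π b ξ‖ = 1 ∧ ∀ x ∈ F, ‖⟪ξ, π x (π b ξ)⟫_ℂ‖ < ε ∧
      ‖⟪π b ξ, π x (π b ξ)⟫_ℂ - ⟪ξ, π x ξ⟫_ℂ‖ < ε := by
  classical
  let h : F ⊕ F → A := Sum.elim (fun x => (realPart x.1 : A)) (fun x => (imaginaryPart x.1 : A))
  have hh : ∀ i, IsSelfAdjoint (h i) := by
    rintro (i | i)
    · exact (realPart i.1).2
    · exact (imaginaryPart i.1).2
  let V : Submodule ℂ H := Submodule.span ℂ (Set.range fun x : F => π (star x.1) ξ)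
  have hV : FiniteDimensional ℂ V := FiniteDimensional.span_of_finite ℂ (Set.finite_range _)
  obtain ⟨_, ⟨η, ⟨hηV, hη⟩, rfl⟩, hd⟩ := Metric.mem_closure_iff.1
    (aux_glimm π hess aux_dec h hh ξ hξ V hV) (ε / 2) (by positivity)
  have hcoord : ∀ i, |(⟪η, π (h i) η⟫_ℂ).re - (⟪ξ, π (h i) ξ⟫_ℂ).re| < ε / 2 := by
    intro i
    have := (dist_pi_lt_iff (by positivity)).1 hd i
    rw [dist_comm, Real.dist_eq] at this
    exact this
  have hreal : ∀ i (ζ : H), ⟪ζ, π (h i) ζ⟫_ℂ = ((⟪ζ, π (h i) ζ⟫_ℂ).re : ℂ) := by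
    intro i ζ
    refine (Complex.conj_eq_iff_re.1 ?_).symm
    rw [inner_conj_symm, ← aux_sa_s7 π _ (hh i)]
  have hdecomp : ∀ (x : F) (ζ : H), ⟪ζ, π x.1 ζ⟫_ℂ =
      ⟪ζ, π (h (Sum.inl x)) ζ⟫_ℂ + Complex.I * ⟪ζ, π (h (Sum.inr x)) ζ⟫_ℂ := by
    intro x ζ
    have : π x.1 = π (h (Sum.inl x)) + Complex.I • π (h (Sum.inr x)) := by
      rw [← map_smul, ← map_add]
      congr 1
      exact (realPart_add_I_smul_imaginaryPart x.1).symm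
    rw [this]
    simp [inner_add_right, inner_smul_right]
  have hA : ∀ x : F, ‖⟪η, π x.1 η⟫_ℂ - ⟪ξ, π x.1 ξ⟫_ℂ‖ < ε := by
    intro x
    rw [hdecomp x η, hdecomp x ξ, hreal (Sum.inl x) η, hreal (Sum.inr x) η,
      hreal (Sum.inl x) ξ, hreal (Sum.inr x) ξ]
    have h1 := hcoord (Sum.inl x)
    have h2 := hcoord (Sum.inr x)
    generalize (⟪η, π (h (Sum.inl x)) η⟫_ℂ).re = a1 at *
    generalize (⟪η, π (h (Sum.inr x)) η⟫_ℂ).re = a2 at *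
    generalize (⟪ξ, π (h (Sum.inl x)) ξ⟫_ℂ).re = a3 at *
    generalize (⟪ξ, π (h (Sum.inr x)) ξ⟫_ℂ).re = a4 at *
    calc ‖(a1 : ℂ) + Complex.I * a2 - (a3 + Complex.I * a4)‖
        = ‖((a1 - a3 : ℝ) : ℂ) + Complex.I * ((a2 - a4 : ℝ) : ℂ)‖ := by
          congr 1; push_cast; ring
      _ ≤ ‖((a1 - a3 : ℝ) : ℂ)‖ + ‖Complex.I * ((a2 - a4 : ℝ) : ℂ)‖ := norm_add_le _ _
      _ = |a1 - a3| + |a2 - a4| := by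
          rw [norm_mul, Complex.norm_I, one_mul, Complex.norm_real, Complex.norm_real]; rfl
      _ < ε := by linarith
  have hB : ∀ x : F, ⟪ξ, π x.1 η⟫_ℂ = 0 := by
    intro x
    have : ⟪π (star x.1) ξ, η⟫_ℂ = 0 := hηV _ (Submodule.subset_span ⟨x, rfl⟩)
    rw [map_star, ContinuousLinearMap.star_eq_adjoint,
      ContinuousLinearMap.adjoint_inner_left] at this
    exact this
  let U : Set H := {ζ | ζ ≠ 0} ∩ ⋂ x : F, ({ζ | ‖⟪ξ, π x.1 ζ⟫_ℂ‖ < ε * ‖ζ‖} ∩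
    {ζ | ‖⟪ζ, π x.1 ζ⟫_ℂ - ⟪ξ, π x.1 ξ⟫_ℂ * (‖ζ‖ : ℂ) ^ 2‖ < ε * ‖ζ‖ ^ 2})
  have hU : IsOpen U := by
    refine isOpen_ne.inter (isOpen_iInter_of_finite fun x => ?_)
    exact (isOpen_lt (by fun_prop) (by fun_prop)).inter (isOpen_lt (by fun_prop) (by fun_prop))
  have hηU : η ∈ U := by
    refine ⟨fun h0 => by simp [h0] at hη, Set.mem_iInter.2 fun x => ⟨?_, ?_⟩⟩
    · simp only [Set.mem_ofPred_eq, hB x, hη]; simpa using hε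
    · simp only [Set.mem_ofPred_eq, hη]; simpa using hA x
  obtain ⟨b, hb0, hb⟩ := hcyc.exists_mem_open hU ⟨η, hηU⟩
  rw [Set.mem_iInter] at hb
  have hn : 0 < ‖π b ξ‖ := norm_pos_iff.2 hb0
  have hb' : π ((‖π b ξ‖⁻¹ : ℂ) • b) ξ = (‖π b ξ‖⁻¹ : ℂ) • π b ξ := by simp
  refine ⟨(‖π b ξ‖⁻¹ : ℂ) • b, ?_, fun x hx => ?_⟩
  · rw [hb', norm_smul]; simp [hn.ne']
  · obtain ⟨h1, h2⟩ := hb ⟨x, hx⟩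
    simp only [Set.mem_ofPred_eq] at h1 h2
    rw [hb']
    generalize π b ξ = ζ at *
    have hnc : (‖ζ‖ : ℂ) ≠ 0 := by exact_mod_cast hn.ne'
    constructor
    · rw [map_smul, inner_smul_right, norm_mul, norm_inv, Complex.norm_real, norm_norm,
        inv_mul_lt_iff₀ hn, mul_comm]
      exact h1
    · have : ⟪(‖ζ‖⁻¹ : ℂ) • ζ, π x ((‖ζ‖⁻¹ : ℂ) • ζ)⟫_ℂ - ⟪ξ, π x ξ⟫_ℂ =
          ((‖ζ‖ : ℂ) ^ 2)⁻¹ * (⟪ζ, π x ζ⟫_ℂ - ⟪ξ, π x ξ⟫_ℂ * (‖ζ‖ : ℂ) ^ 2) := by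
        rw [map_smul, inner_smul_right, inner_smul_left, map_inv₀, Complex.conj_ofReal]
        field_simp
      rw [this, norm_mul, norm_inv, norm_pow, Complex.norm_real, norm_norm,
        inv_mul_lt_iff₀ (by positivity), mul_comm (‖ζ‖ ^ 2)]
      exact h2

/-- Let `φ` be a state on a unital C*-algebra `B` and `B₀` a unital C*-subalgebra of the
centralizer of `φ` admitting a `φ`-preserving conditional expectation `E : B → B₀`. If
`φ` restricted to `B₀` is GNS-essential, then for every finite `F ⊆ B` and `ε > 0` there
is `b ∈ B₀` with `φ(b* b) = 1 = φ(b b*)`, `|φ(x b)| < ε` and `|φ(b* x b) - φ(x)| < ε`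
for all `x ∈ F`. -/
theorem centralizer_approximation {B : Type} [NormedRing B] [StarRing B] [CStarRing B]
    [NormedAlgebra ℂ B] [CompleteSpace B] [StarModule ℂ B]
    (φ : B →ₗ[ℂ] ℂ) (hφ_unital : φ 1 = 1) (hφ_pos : ∀ a : B, 0 ≤ φ (star a * a))
    (B₀ : StarSubalgebra ℂ B) (hB₀_closed : IsClosed (B₀ : Set B))
    (hB₀_central : ∀ x ∈ B₀, ∀ b : B, φ (x * b) = φ (b * x))
    (E : B →ₗ[ℂ] B)
    (hE_range : ∀ x : B, E x ∈ B₀)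
    (hE_id : ∀ b ∈ B₀, E b = b)
    (hE_bimod : ∀ b ∈ B₀, ∀ c ∈ B₀, ∀ x : B, E (b * x * c) = b * E x * c)
    (hE_pos : ∀ x : B, (∃ c : B, x = star c * c) → ∃ c : B, E x = star c * c)
    (hE_φ : ∀ x : B, φ (E x) = φ x)
    (hφ₀_ess : IsGNSEssential (φ.comp B₀.subtype.toAlgHom.toLinearMap))
    (F : Finset B) (ε : ℝ) (hε : 0 < ε) :
    ∃ b ∈ B₀, φ (star b * b) = 1 ∧ φ (b * star b) = 1 ∧
      ∀ x ∈ F, ‖φ (x * b)‖ < ε ∧ ‖φ (star b * x * b) - φ x‖ < ε := by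
  classical
  letI : CStarAlgebra B := {}
  haveI : IsClosed (B₀ : Set B) := hB₀_closed
  obtain ⟨w⟩ := hφ₀_ess
  obtain ⟨H, π, ξ, hξ, hcyc, hvec, hess⟩ := w
  have hvec' : ∀ x : B₀, φ x.1 = ⟪ξ, π x ξ⟫_ℂ := hvec
  have hstar : ∀ (b : B₀) (u v : H), ⟪u, π (star b) v⟫_ℂ = ⟪π b u, v⟫_ℂ := by
    intro b u v
    rw [map_star, ContinuousLinearMap.star_eq_adjoint, ContinuousLinearMap.adjoint_inner_right]
  obtain ⟨b, hb1, hb⟩ := aux_final (A := B₀) π hess ξ hξ hcyc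
    (F.image fun x => ⟨E x, hE_range x⟩) ε hε
  have hbb : φ (star b.1 * b.1) = 1 := by
    have := hvec' (star b * b)
    rw [map_mul, mul_apply_eq_comp, hstar, inner_self_eq_norm_sq_to_K, hb1] at this
    simpa using this
  refine ⟨b.1, b.2, hbb, ?_, fun x hx => ?_⟩
  · rw [hB₀_central b.1 b.2, hbb]
  · obtain ⟨h1, h2⟩ := hb ⟨E x, hE_range x⟩ (Finset.mem_image_of_mem _ hx)
    have e1 : φ (x * b.1) = ⟪ξ, π ⟨E x, hE_range x⟩ (π b ξ)⟫_ℂ := by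
      have h3 := hvec' (⟨E x, hE_range x⟩ * b)
      rw [map_mul, mul_apply_eq_comp] at h3
      rw [← h3, ← hE_φ]
      have := hE_bimod 1 (one_mem B₀) b.1 b.2 x
      rw [one_mul, one_mul] at this
      rw [this]
      rfl
    have e2 : φ (star b.1 * x * b.1) = ⟪π b ξ, π ⟨E x, hE_range x⟩ (π b ξ)⟫_ℂ := by
      have h3 := hvec' (star b * (⟨E x, hE_range x⟩ * b))
      rw [map_mul, map_mul, mul_apply_eq_comp, mul_apply_eq_comp, hstar] at h3
      rw [← h3, ← hE_φ, hE_bimod _ (star_mem b.2) b.1 b.2 x, mul_assoc]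
      rfl
    have e3 : φ x = ⟪ξ, π ⟨E x, hE_range x⟩ ξ⟫_ℂ := by
      rw [← hvec', hE_φ]
    rw [e1, e2, e3]
    exact ⟨h1, h2⟩
end
end
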